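/- arXiv:0905.3253 — 3 statements merged into one kernel-verified Lean document; each statement's English description precedes it below -/
import Mathlib

section
/- Let n ≥ 1 and L ∈ ℝ. Then on the open set (0,∞)^n of points x = (x_1,…,x_n) with all coordinates positive, one has the identity of smooth functions ∏_{a=1}^{n} (∂/∂x_a) [ Δ_n(x) · (x_1⋯x_n)^L ] = (∏_{b=1}^{n} (L + b − 1)) · Δ_n(x) · (x_1⋯x_n)^{L−1}, where the left-hand side is the composition of the n commuting first-order partial derivatives applied to the function x ↦ Δ_n(x)(x_1⋯x_n)^L. -/
open Finset

/-- The Vandermonde determinant `Δ_n(x) = ∏_{a<b} (x_a - x_b)`. -/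
noncomputable def vandermondeProd {n : ℕ} (x : Fin n → ℝ) : ℝ :=
  ∏ a : Fin n, ∏ b ∈ Finset.Ioi a, (x a - x b)

/-- The partial derivative `∂/∂x_a` of a function of `n` real variables. -/
noncomputable def partialDeriv {n : ℕ} (a : Fin n) (f : (Fin n → ℝ) → ℝ) :
    (Fin n → ℝ) → ℝ :=
  fun x => fderiv ℝ f x (Pi.single a 1)

lemma vandermondeProd_eq_sum {n : ℕ} (x : Fin n → ℝ) :
    vandermondeProd x = ∑ σ : Equiv.Perm (Fin n),
      ((Equiv.Perm.sign σ : ℤ) : ℝ) * ∏ i, (-x i) ^ (σ i : ℕ) := by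
  have h : vandermondeProd x = (Matrix.vandermonde fun i => -x i).transpose.det := by
    rw [Matrix.det_transpose, Matrix.det_vandermonde, vandermondeProd]
    refine prod_congr rfl fun a _ => prod_congr rfl fun b _ => ?_
    ring
  rw [h, Matrix.det_apply']
  simp [Matrix.vandermonde_apply]

lemma hasFDerivAt_prod_apply {ι : Type*} [Fintype ι] [DecidableEq ι] {g : ι → ℝ → ℝ}
    {g' : ι → ℝ} {x : ι → ℝ} (hg : ∀ i, HasDerivAt (g i) (g' i) (x i)) :
    HasFDerivAt (fun y : ι → ℝ => ∏ i, g i (y i))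
      (∑ i, (∏ j ∈ univ.erase i, g j (x j)) •
        g' i • (ContinuousLinearMap.proj i : (ι → ℝ) →L[ℝ] ℝ)) x :=
  HasFDerivAt.finsetProd fun i _ =>
    (hg i).comp_hasFDerivAt (f := fun y : ι → ℝ => y i) x (hasFDerivAt_apply i x)

/-- Partial derivative of a sum of products of functions of one variable. -/
lemma partialDeriv_sum_prod {n : ℕ} {κ : Type*} [Fintype κ] (c : κ → ℝ)
    {g : κ → Fin n → ℝ → ℝ} {g' : κ → Fin n → ℝ} {x : Fin n → ℝ}
    (hg : ∀ k i, HasDerivAt (g k i) (g' k i) (x i)) (a : Fin n) :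
    partialDeriv a (fun y => ∑ k, c k * ∏ i, g k i (y i)) x =
      ∑ k, c k * (g' k a * ∏ i ∈ univ.erase a, g k i (x i)) := by
  have h := HasFDerivAt.fun_sum (u := univ) fun k _ =>
    (hasFDerivAt_prod_apply (hg k)).const_mul (c k)
  rw [partialDeriv, h.fderiv]
  simp only [_root_.sum_apply, smul_apply,
    ContinuousLinearMap.proj_apply, smul_eq_mul]
  refine sum_congr rfl fun k _ => ?_
  rw [sum_eq_single a (fun i _ hi => by simp [hi]) (by simp)]
  simp only [Pi.single_eq_same]
  ring

/-- Iterated partial derivatives along distinct coordinates of a sum of products of functions of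
one variable, on the positive orthant. -/
lemma foldr_partialDeriv_sum_prod {n : ℕ} {κ : Type*} [Fintype κ] (c : κ → ℝ)
    {f f' : κ → Fin n → ℝ → ℝ}
    (hf : ∀ k i t, 0 < t → HasDerivAt (f k i) (f' k i t) t)
    (hf' : ∀ k i t, 0 < t → DifferentiableAt ℝ (f' k i) t)
    {F : (Fin n → ℝ) → ℝ}
    (hF : ∀ y, (∀ i, 0 < y i) → F y = ∑ k, c k * ∏ i, f k i (y i))
    (l : List (Fin n)) (hl : l.Nodup) (x : Fin n → ℝ) (hx : ∀ i, 0 < x i) :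
    l.foldr partialDeriv F x =
      ∑ k, c k * ∏ i, (if i ∈ l then f' k i else f k i) (x i) := by
  induction l generalizing x with
  | nil => simpa using hF x hx
  | cons a l ih =>
    obtain ⟨ha, hl⟩ := List.nodup_cons.1 hl
    have hpos : ∀ᶠ y in nhds x, ∀ i : Fin n, 0 < y i :=
      Filter.eventually_all.2 fun i => (continuous_apply i).continuousAt.eventually_const_lt (hx i)
    have heq : l.foldr partialDeriv F =ᶠ[nhds x]
        fun y => ∑ k, c k * ∏ i, (if i ∈ l then f' k i else f k i) (y i) :=
      hpos.mono fun y hy => ih hl y hy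
    have hd : ∀ k i, HasDerivAt (if i ∈ l then f' k i else f k i)
        (if i ∈ l then deriv (f' k i) (x i) else f' k i (x i)) (x i) := fun k i => by
      split_ifs
      · exact (hf' k i _ (hx i)).hasDerivAt
      · exact hf k i _ (hx i)
    calc (a :: l).foldr partialDeriv F x
        = partialDeriv a
            (fun y => ∑ k, c k * ∏ i, (if i ∈ l then f' k i else f k i) (y i)) x := by
          rw [List.foldr_cons, partialDeriv, heq.fderiv_eq, partialDeriv]
      _ = _ := by
          rw [partialDeriv_sum_prod c hd a]
          refine sum_congr rfl fun k _ => ?_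
          rw [← mul_prod_erase univ _ (mem_univ a), if_neg ha, if_pos List.mem_cons_self]
          congr 2
          refine prod_congr rfl fun i hi => ?_
          simp [ne_of_mem_erase hi]

lemma hasDerivAt_neg_pow_mul_rpow (m : ℕ) (L : ℝ) {t : ℝ} (ht : 0 < t) :
    HasDerivAt (fun t : ℝ => (-t) ^ m * t ^ L) ((L + m) * ((-t) ^ m * t ^ (L - 1))) t := by
  have h := ((hasDerivAt_neg t).fun_pow m).mul (Real.hasDerivAt_rpow_const (p := L) (.inl ht.ne'))
  refine h.congr_deriv ?_
  have hL : t ^ L = t * t ^ (L - 1) := by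
    rw [Real.rpow_sub_one ht.ne', mul_div_cancel₀ _ ht.ne']
  rw [hL]
  cases m with
  | zero => simp
  | succ m => simp only [Nat.add_sub_cancel, pow_succ]; push_cast; ring

lemma vandermondeProd_mul_rpow_eq_sum {n : ℕ} (L : ℝ) {x : Fin n → ℝ} (hx : ∀ i, 0 < x i) :
    vandermondeProd x * (∏ i, x i) ^ L = ∑ σ : Equiv.Perm (Fin n),
      ((Equiv.Perm.sign σ : ℤ) : ℝ) * ∏ i, ((-x i) ^ (σ i : ℕ) * x i ^ L) := by
  rw [vandermondeProd_eq_sum, sum_mul, ← Real.finsetProd_rpow _ _ fun i _ => (hx i).le]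
  simp only [prod_mul_distrib, mul_assoc]

/-- Eq. (C.20) of the paper: on `(0,∞)^n`,
`∏_a ∂/∂x_a [Δ_n(x) (x_1⋯x_n)^L] = (∏_{b=1}^n (L+b-1)) Δ_n(x) (x_1⋯x_n)^{L-1}`. -/
theorem sekiguchi_power_action (n : ℕ) (hn : 1 ≤ n) (L : ℝ)
    (x : Fin n → ℝ) (hx : ∀ i, 0 < x i) :
    (List.finRange n).foldr partialDeriv
        (fun y => vandermondeProd y * (∏ i : Fin n, y i) ^ L) x
      = (∏ b : Fin n, (L + (b : ℕ))) *
        (vandermondeProd x * (∏ i : Fin n, x i) ^ (L - 1)) := by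
  have hd := fun (σ : Equiv.Perm (Fin n)) (i : Fin n) (L t : ℝ) (ht : 0 < t) =>
    hasDerivAt_neg_pow_mul_rpow (σ i) L ht
  rw [foldr_partialDeriv_sum_prod _ (fun σ i t ht => hd σ i L t ht)
    (fun σ i t ht => ((hd σ i (L - 1) t ht).differentiableAt.const_mul _))
    (fun y hy => vandermondeProd_mul_rpow_eq_sum L hy) _ (List.nodup_finRange n) x hx,
    vandermondeProd_mul_rpow_eq_sum (L - 1) hx, mul_sum]
  refine sum_congr rfl fun σ _ => ?_
  simp only [List.mem_finRange, if_true]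
  rw [prod_mul_distrib, Equiv.prod_comp σ fun b : Fin n => L + ((b : ℕ) : ℝ)]
  ring
end

section
/- Let N ≥ 1, let μ be the normalized Haar probability measure on the unitary group U(N), and for y, x ∈ ℝ^N define φ(y,x) = ∫_{U(N)} exp(i · tr(diag(y) · U · diag(x) · U*)) dμ(U). Then for every B ∈ ℝ and every y ∈ ℝ^N, the smooth function x ↦ Δ_N(x)·φ(y,x) on ℝ^N satisfies [∏_{a=1}^{N} (∂/∂x_a + iB)] (Δ_N(x) φ(y,x)) = (∏_{a=1}^{N} i(y_a + B)) · Δ_N(x) φ(y,x), where the operator on the left is the composition of the N commuting first-order operators ∂/∂x_a + iB. -/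
open Finset MeasureTheory

/-- The first-order operator `∂/∂x_a + iB` acting on complex-valued functions of `n` real
variables. -/
noncomputable def shiftedPartialDeriv {n : ℕ} (B : ℝ) (a : Fin n)
    (f : (Fin n → ℝ) → ℂ) : (Fin n → ℝ) → ℂ :=
  fun x => fderiv ℝ f x (Pi.single a 1) + Complex.I * (B : ℂ) * f x

/-- The ordinary matrix Bessel function
`φ(y,x) = ∫_{U(N)} exp(i tr(diag(y) U diag(x) U*)) dμ(U)`. -/
noncomputable def matrixBessel (N : ℕ)
    [MeasurableSpace (Matrix.unitaryGroup (Fin N) ℂ)]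
    (μ : Measure (Matrix.unitaryGroup (Fin N) ℂ)) (y x : Fin N → ℝ) : ℂ :=
  ∫ U : Matrix.unitaryGroup (Fin N) ℂ,
    Complex.exp (Complex.I *
      (Matrix.diagonal (fun a => (y a : ℂ)) * (U : Matrix (Fin N) (Fin N) ℂ) *
        Matrix.diagonal (fun a => (x a : ℂ)) *
        star (U : Matrix (Fin N) (Fin N) ℂ)).trace) ∂μ

open scoped ContDiff

attribute [local instance] Matrix.linftyOpNormedRing Matrix.linftyOpNormedAlgebra

section ParametricIntegral

variable {K : Type*} [TopologicalSpace K] [CompactSpace K] [MeasurableSpace K] [BorelSpace K]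
  (μ : Measure K) [IsFiniteMeasure μ]

theorem Continuous.integrable_of_compactSpace {E : Type*} [NormedAddCommGroup E]
    [SecondCountableTopologyEither K E]
    {f : K → E} (hf : Continuous f) : Integrable f μ := by
  rw [← integrableOn_univ]
  exact hf.continuousOn.integrableOn_compact' isCompact_univ MeasurableSet.univ

theorem hasFDerivAt_integral_of_compactSpace [SecondCountableTopology K]
    {H : Type*} [NormedAddCommGroup H] [NormedSpace ℝ H] [ProperSpace H]
    {F : H → K → ℂ} {F' : H → K → H →L[ℝ] ℂ}
    (hF : ∀ x, Continuous (F x)) (hF' : Continuous fun p : H × K => F' p.1 p.2)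
    (hd : ∀ x k, HasFDerivAt (fun z => F z k) (F' x k) x) (x : H) :
    HasFDerivAt (fun z => ∫ k, F z k ∂μ) (∫ k, F' x k ∂μ) x := by
  obtain ⟨C, hC⟩ := ((isCompact_closedBall x (1 : ℝ)).prod
    (isCompact_univ (X := K))).exists_bound_of_continuousOn hF'.continuousOn
  refine hasFDerivAt_integral_of_dominated_of_fderiv_le (bound := fun _ => C)
    (Metric.closedBall_mem_nhds x one_pos)
    (Filter.Eventually.of_forall fun z => (hF z).aestronglyMeasurable)
    ((hF x).integrable_of_compactSpace μ) ?_ ?_ (integrable_const _) ?_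
  · exact (hF'.comp (Continuous.prodMk_right x)).aestronglyMeasurable
  · exact Filter.Eventually.of_forall fun k z hz => hC (z, k) ⟨hz, Set.mem_univ _⟩
  · exact Filter.Eventually.of_forall fun k z _ => hd z k

theorem integral_deriv_eq_zero_of_compactSpace [SecondCountableTopology K]
    {F F' : ℝ → K → ℂ} {c : ℂ}
    (hF : ∀ t, Continuous (F t)) (hF' : Continuous fun p : ℝ × K => F' p.1 p.2)
    (hd : ∀ t k, HasDerivAt (fun s => F s k) (F' t k) t)
    (hc : ∀ t, ∫ k, F t k ∂μ = c) (t : ℝ) : ∫ k, F' t k ∂μ = 0 := by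
  have hF'' : Continuous fun p : ℝ × K => ContinuousLinearMap.toSpanSingleton ℝ (F' p.1 p.2) :=
    (ContinuousLinearMap.toSpanSingletonCLE (𝕜 := ℝ) (E := ℂ)).continuous.comp hF'
  have hderiv := hasFDerivAt_integral_of_compactSpace μ hF hF''
    (fun t k => (hd t k).hasFDerivAt) t
  simp only [hc] at hderiv
  have h := congrArg (fun L : ℝ →L[ℝ] ℂ => L 1) ((hasFDerivAt_const c t).unique hderiv)
  rw [ContinuousLinearMap.integral_apply] at h
  · simpa using h.symm
  · exact (hF''.comp (Continuous.prodMk_right t)).integrable_of_compactSpace μ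

end ParametricIntegral

section UnitaryGroup

variable {N : ℕ}

instance compactSpace_unitaryGroup : CompactSpace (Matrix.unitaryGroup (Fin N) ℂ) := by
  refine isCompact_iff_compactSpace.mp ?_
  refine IsCompact.of_isClosed_subset
    (isCompact_univ_pi fun _ : Fin N => isCompact_univ_pi fun _ : Fin N =>
      isCompact_closedBall (0 : ℂ) 1) (isClosed_unitary (R := Matrix (Fin N) (Fin N) ℂ)) ?_
  intro U hU i _ j _
  simpa using entry_norm_bound_of_unitary hU i j

instance secondCountableTopology_unitaryGroup :
    SecondCountableTopology (Matrix.unitaryGroup (Fin N) ℂ) := by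
  have : SecondCountableTopology (Matrix (Fin N) (Fin N) ℂ) :=
    inferInstanceAs (SecondCountableTopology (Fin N → Fin N → ℂ))
  exact TopologicalSpace.Subtype.secondCountableTopology _

/-- The conjugate `U* Z U` of a matrix by a unitary matrix. -/
def unitaryConj (Z : Matrix (Fin N) (Fin N) ℂ) (U : Matrix.unitaryGroup (Fin N) ℂ) :
    Matrix (Fin N) (Fin N) ℂ :=
  star (U : Matrix (Fin N) (Fin N) ℂ) * Z * (U : Matrix (Fin N) (Fin N) ℂ)

theorem continuous_unitaryConj (Z : Matrix (Fin N) (Fin N) ℂ) : Continuous (unitaryConj Z) := by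
  unfold unitaryConj; fun_prop

theorem unitaryConj_mul (Z : Matrix (Fin N) (Fin N) ℂ) (U V : Matrix.unitaryGroup (Fin N) ℂ) :
    unitaryConj Z (U * V) = star (V : Matrix (Fin N) (Fin N) ℂ) * unitaryConj Z U * V := by
  simp [unitaryConj, mul_assoc]

variable [MeasurableSpace (Matrix.unitaryGroup (Fin N) ℂ)]
  [BorelSpace (Matrix.unitaryGroup (Fin N) ℂ)]
  (μ : Measure (Matrix.unitaryGroup (Fin N) ℂ)) [μ.IsHaarMeasure] [IsProbabilityMeasure μ]

theorem isMulRightInvariant_unitaryGroup : μ.IsMulRightInvariant := by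
  refine ⟨fun g => ?_⟩
  have : IsProbabilityMeasure (Measure.map (· * g) μ) :=
    Measure.isProbabilityMeasure_map (by fun_prop)
  exact Measure.isHaarMeasure_eq_of_isProbabilityMeasure _ _

theorem integral_fderiv_commutator_of_skewAdjoint {Φ : Matrix (Fin N) (Fin N) ℂ → ℂ}
    (hΦ : ContDiff ℂ 1 Φ) (Z A : Matrix (Fin N) (Fin N) ℂ)
    (hA : A ∈ skewAdjoint (Matrix (Fin N) (Fin N) ℂ)) :
    ∫ U, fderiv ℂ Φ (unitaryConj Z U) (unitaryConj Z U * A - A * unitaryConj Z U) ∂μ = 0 := by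
  have := isMulRightInvariant_unitaryGroup μ
  have hcs : ContinuousStar (Matrix (Fin N) (Fin N) ℂ) := ⟨continuous_id.matrix_conjTranspose⟩
  have hE : Continuous fun t : ℝ => NormedSpace.exp (t • A) :=
    NormedSpace.exp_continuous.comp (by fun_prop)
  have hE' : Continuous fun t : ℝ => NormedSpace.exp (t • -A) :=
    NormedSpace.exp_continuous.comp (by fun_prop)
  have hM := continuous_unitaryConj Z
  have hdΦ : Continuous (fderiv ℂ Φ) := hΦ.continuous_fderiv one_ne_zero
  have hmem (t : ℝ) : NormedSpace.exp (t • A) ∈ Matrix.unitaryGroup (Fin N) ℂ :=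
    @NormedSpace.exp_mem_unitary_of_mem_skewAdjoint _ _ _ _ _ hcs _ (skewAdjoint.smul_mem t hA)
  have hstar (t : ℝ) : star (NormedSpace.exp (t • A)) = NormedSpace.exp (t • -A) := by
    rw [NormedSpace.star_exp, skewAdjoint.mem_iff.1 (skewAdjoint.smul_mem t hA), smul_neg]
  let F (t : ℝ) (U : Matrix.unitaryGroup (Fin N) ℂ) : ℂ :=
    Φ (NormedSpace.exp (t • -A) * unitaryConj Z U * NormedSpace.exp (t • A))
  let F' (t : ℝ) (U : Matrix.unitaryGroup (Fin N) ℂ) : ℂ :=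
    fderiv ℂ Φ (NormedSpace.exp (t • -A) * unitaryConj Z U * NormedSpace.exp (t • A))
      ((NormedSpace.exp (t • -A) * -A) * unitaryConj Z U * NormedSpace.exp (t • A) +
        (NormedSpace.exp (t • -A) * unitaryConj Z U) * (NormedSpace.exp (t • A) * A))
  have hconst (t : ℝ) : ∫ U, F t U ∂μ = ∫ U, Φ (unitaryConj Z U) ∂μ := by
    rw [← integral_mul_right_eq_self (fun U => Φ (unitaryConj Z U))
      (⟨_, hmem t⟩ : Matrix.unitaryGroup (Fin N) ℂ)]
    simp only [F, unitaryConj_mul, hstar]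
  have key := integral_deriv_eq_zero_of_compactSpace μ (F := F) (F' := F') ?_ ?_ ?_ hconst 0
  · simpa [F', sub_eq_neg_add] using key
  · intro t
    exact hΦ.continuous.comp (by fun_prop)
  · exact (hdΦ.comp (by fun_prop)).clm_apply (by fun_prop)
  · intro t U
    have h1 := ((hasDerivAt_exp_smul_const (𝕂 := ℝ) (-A) t).mul_const (unitaryConj Z U)).mul
      (hasDerivAt_exp_smul_const (𝕂 := ℝ) A t)
    exact ((hΦ.differentiable one_ne_zero _).hasFDerivAt.restrictScalars ℝ).comp_hasDerivAt t h1

theorem integral_fderiv_commutator {Φ : Matrix (Fin N) (Fin N) ℂ → ℂ}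
    (hΦ : ContDiff ℂ 1 Φ) (Z A : Matrix (Fin N) (Fin N) ℂ) :
    ∫ U, fderiv ℂ Φ (unitaryConj Z U) (unitaryConj Z U * A - A * unitaryConj Z U) ∂μ = 0 := by
  have hint (A : Matrix (Fin N) (Fin N) ℂ) : Integrable (fun U =>
      fderiv ℂ Φ (unitaryConj Z U) (unitaryConj Z U * A - A * unitaryConj Z U)) μ := by
    refine Continuous.integrable_of_compactSpace μ ?_
    have hM := continuous_unitaryConj Z
    have hdΦ : Continuous (fderiv ℂ Φ) := hΦ.continuous_fderiv one_ne_zero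
    exact (hdΦ.comp hM).clm_apply (by fun_prop)
  let P : Matrix (Fin N) (Fin N) ℂ := (2⁻¹ : ℂ) • (A - star A)
  let Q : Matrix (Fin N) (Fin N) ℂ := (-Complex.I * 2⁻¹) • (A + star A)
  have hP : P ∈ skewAdjoint (Matrix (Fin N) (Fin N) ℂ) := by
    rw [skewAdjoint.mem_iff]; ext i j; simp [P]; ring
  have hQ : Q ∈ skewAdjoint (Matrix (Fin N) (Fin N) ℂ) := by
    rw [skewAdjoint.mem_iff]; ext i j; simp [Q]
  have hA : A = P + Complex.I • Q := by
    ext i j; simp [P, Q]; linear_combination ((A i j + (starRingEnd ℂ) (A j i)) / 2) * Complex.I_sq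
  have key (U : Matrix.unitaryGroup (Fin N) ℂ) :
      fderiv ℂ Φ (unitaryConj Z U) (unitaryConj Z U * A - A * unitaryConj Z U) =
      fderiv ℂ Φ (unitaryConj Z U) (unitaryConj Z U * P - P * unitaryConj Z U) +
      Complex.I * fderiv ℂ Φ (unitaryConj Z U) (unitaryConj Z U * Q - Q * unitaryConj Z U) := by
    rw [← smul_eq_mul (Complex.I), ← map_smul, ← map_add]
    congr 1
    conv_lhs => rw [hA]
    simp only [mul_add, add_mul, Matrix.mul_smul, Matrix.smul_mul, smul_sub]
    abel
  simp_rw [key]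
  rw [integral_add (hint P) ((hint Q).const_mul _), integral_const_mul,
    integral_fderiv_commutator_of_skewAdjoint μ hΦ Z P hP,
    integral_fderiv_commutator_of_skewAdjoint μ hΦ Z Q hQ]
  simp

end UnitaryGroup

section PrincipalMinor

variable {N : ℕ}

/-- The matrix whose rows indexed by `S` are those of `M`, the other rows being those of the
identity, so that its determinant is the principal minor of `M` indexed by `S`. -/
def principalRows (S : Finset (Fin N)) (M : Matrix (Fin N) (Fin N) ℂ) :
    Matrix (Fin N) (Fin N) ℂ :=
  Matrix.of fun i j => if i ∈ S then M i j else (Pi.single i 1 : Fin N → ℂ) j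

/-- The minor of `M` whose rows are indexed by `S` and whose columns are obtained from `S` by
replacing `a` by `c`, up to sign. -/
noncomputable def mixedMinor (S : Finset (Fin N)) (c a : Fin N)
    (M : Matrix (Fin N) (Fin N) ℂ) : ℂ :=
  ((principalRows S M).updateRow c (Pi.single a 1)).det

theorem contDiff_matrix_apply (i j : Fin N) :
    ContDiff ℂ ω fun M : Matrix (Fin N) (Fin N) ℂ => M i j :=
  (LinearMap.toContinuousLinearMap (Matrix.entryLinearMap ℂ ℂ i j)).contDiff

theorem contDiff_det_of_entries {A : Matrix (Fin N) (Fin N) ℂ → Matrix (Fin N) (Fin N) ℂ}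
    (hA : ∀ i j, ContDiff ℂ ω fun M => A M i j) : ContDiff ℂ ω fun M => (A M).det := by
  simp only [Matrix.det_apply]
  exact ContDiff.sum fun σ _ => (contDiff_prod fun i _ => hA _ _).const_smul _

theorem contDiff_principalRows_apply (S : Finset (Fin N)) (i j : Fin N) :
    ContDiff ℂ ω fun M => principalRows S M i j := by
  by_cases hi : i ∈ S
  · simpa [principalRows, hi] using contDiff_matrix_apply i j
  · simpa [principalRows, hi] using contDiff_const

theorem contDiff_det_principalRows (S : Finset (Fin N)) :
    ContDiff ℂ ω fun M => (principalRows S M).det :=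
  contDiff_det_of_entries (contDiff_principalRows_apply S)

theorem contDiff_mixedMinor (S : Finset (Fin N)) (c a : Fin N) :
    ContDiff ℂ ω (mixedMinor S c a) := by
  refine contDiff_det_of_entries fun i j => ?_
  by_cases hi : i = c
  · subst hi; simpa using contDiff_const
  · simpa [Matrix.updateRow_ne hi] using contDiff_principalRows_apply S i j

theorem det_principalRows_insert {S : Finset (Fin N)} {c : Fin N} (hc : c ∉ S)
    (M : Matrix (Fin N) (Fin N) ℂ) :
    (principalRows (insert c S) M).det =
      M c c * (principalRows S M).det + ∑ a ∈ S, M c a * mixedMinor S c a M := by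
  have hrow (a : Fin N) : (principalRows (insert c S) M).adjugate a c = mixedMinor S c a M := by
    rw [Matrix.adjugate_apply, mixedMinor]
    congr 1
    ext i j
    by_cases hi : i = c
    · subst hi; simp
    · simp [principalRows, hi]
  have hself : mixedMinor S c c M = (principalRows S M).det := by
    rw [mixedMinor]
    congr 1
    ext i j
    by_cases hi : i = c
    · subst hi; simp [principalRows, hc]
    · simp [Matrix.updateRow_ne hi]
  have hzero (a : Fin N) (ha : a ∉ insert c S) : mixedMinor S c a M = 0 := by
    simp only [Finset.mem_insert, not_or] at ha
    refine Matrix.det_zero_of_row_eq (Ne.symm ha.1) ?_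
    ext j
    simp [Matrix.updateRow_ne ha.1, principalRows, ha.2]
  rw [Matrix.det_eq_sum_mul_adjugate_row _ c,
    ← Finset.sum_subset (Finset.subset_univ (insert c S)) fun a _ ha => by rw [hrow, hzero a ha,
      mul_zero], Finset.sum_insert hc]
  have hM (a : Fin N) : principalRows (insert c S) M c a = M c a := by simp [principalRows]
  simp only [hrow, hM, hself]

theorem mixedMinor_add_mul_single {S : Finset (Fin N)} {c a : Fin N} (hc : c ∉ S) (ha : a ∈ S)
    (M : Matrix (Fin N) (Fin N) ℂ) (t : ℂ) :
    mixedMinor S c a (M + t • (M * Matrix.single a c 1)) =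
      mixedMinor S c a M + t * -(principalRows S M).det := by
  have hac : a ≠ c := fun h => hc (h ▸ ha)
  let A := (principalRows S M).updateRow c (Pi.single a 1 + (-t) • Pi.single c 1)
  have hA : (principalRows S (M + t • (M * Matrix.single a c 1))).updateRow c (Pi.single a 1) =
      A.updateCol c (fun k => A k c + t • A k a) := by
    ext i j
    by_cases hj : j = c
    · subst hj
      by_cases hi : i = j
      · subst hi; simp [A, hac]
      · by_cases hS : i ∈ S
        · simp [A, hi, principalRows, hS]
        · have : i ≠ a := fun h => hS (h ▸ ha)
          simp [A, hi, principalRows, hS, this.symm]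
    · by_cases hi : i = c
      · subst hi; simp [A, hj]
      · by_cases hS : i ∈ S
        · simp [A, hi, hj, principalRows, hS]
        · simp [A, hi, hj, principalRows, hS]
  have hself : (principalRows S M).updateRow c (Pi.single c 1) = principalRows S M := by
    ext i j
    by_cases hi : i = c
    · subst hi; simp [principalRows, hc]
    · simp [Matrix.updateRow_ne hi]
  rw [mixedMinor, hA, Matrix.det_updateCol_add_smul_self _ hac.symm, Matrix.det_updateRow_add,
    Matrix.det_updateRow_smul, hself, mixedMinor]
  ring

theorem mixedMinor_add_single_mul {S : Finset (Fin N)} {c a : Fin N} (hc : c ∉ S) (ha : a ∈ S)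
    (M : Matrix (Fin N) (Fin N) ℂ) (t : ℂ) :
    mixedMinor S c a (M + t • (Matrix.single a c 1 * M)) =
      mixedMinor S c a M + t * -(principalRows (insert c (S.erase a)) M).det := by
  have hac : a ≠ c := fun h => hc (h ▸ ha)
  let A := (principalRows S M).updateRow c (Pi.single a 1)
  have hA : (principalRows S (M + t • (Matrix.single a c 1 * M))).updateRow c (Pi.single a 1) =
      A.updateRow a (M a + t • M c) := by
    ext i j
    by_cases hi : i = c
    · subst hi; simp [A, hac.symm]
    · by_cases hia : i = a
      · subst hia; simp [hac, principalRows, ha]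
      · simp [A, hi, hia, principalRows]
  have hself : A.updateRow a (M a) = A := by
    ext i j
    by_cases hia : i = a
    · subst hia; simp [A, hac, principalRows, ha]
    · simp [hia]
  have hswap : A.updateRow a (M c) =
      (principalRows (insert c (S.erase a)) M).submatrix (Equiv.swap a c) id := by
    ext i j
    by_cases hia : i = a
    · subst hia; simp [principalRows]
    · by_cases hi : i = c
      · subst hi; simp [A, hia, principalRows, hac]
      · simp [A, hi, hia, principalRows, Equiv.swap_apply_of_ne_of_ne]
  rw [mixedMinor, hA, Matrix.det_updateRow_add, Matrix.det_updateRow_smul, hself, hswap,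
    Matrix.det_permute, Equiv.Perm.sign_swap hac, mixedMinor]
  simp [A]

end PrincipalMinor

section MatrixAverage

variable {N : ℕ}

/-- The exponent `∑ a, x_a (M_aa - iB)`. -/
noncomputable def shiftedExponent (B : ℝ) (x : Fin N → ℝ) (M : Matrix (Fin N) (Fin N) ℂ) : ℂ :=
  ∑ a, (x a : ℂ) * (M a a - Complex.I * B)

theorem fderiv_apply_of_affine {E : Type*} [NormedAddCommGroup E] [NormedSpace ℂ E]
    {f : E → ℂ} {v h : E} {w : ℂ}
    (hf : DifferentiableAt ℂ f v) (hw : ∀ t : ℂ, f (v + t • h) = f v + t * w) :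
    fderiv ℂ f v h = w := by
  rw [← hf.lineDeriv_eq_fderiv, lineDeriv]
  simp only [hw]
  simp

theorem fderiv_mul_cexp_apply {E : Type*} [NormedAddCommGroup E] [NormedSpace ℂ E]
    {f g : E → ℂ} {v h : E} {f' g' : ℂ} (hf : DifferentiableAt ℂ f v)
    (hg : DifferentiableAt ℂ g v) (hf' : fderiv ℂ f v h = f') (hg' : fderiv ℂ g v h = g') :
    fderiv ℂ (fun v => f v * Complex.exp (g v)) v h = (f' + f v * g') * Complex.exp (g v) := by
  rw [fderiv_fun_mul hf hg.cexp, hg.hasFDerivAt.cexp.fderiv, ← hf', ← hg']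
  simp only [add_apply, smul_apply, smul_eq_mul]
  ring

theorem contDiff_shiftedExponent (B : ℝ) (x : Fin N → ℝ) :
    ContDiff ℂ ω (shiftedExponent B x) :=
  ContDiff.sum fun a _ => contDiff_const.mul ((contDiff_matrix_apply a a).sub contDiff_const)

theorem fderiv_shiftedExponent (B : ℝ) (x : Fin N → ℝ) (M H : Matrix (Fin N) (Fin N) ℂ) :
    fderiv ℂ (shiftedExponent B x) M H = ∑ a, (x a : ℂ) * H a a := by
  refine fderiv_apply_of_affine ((contDiff_shiftedExponent B x).differentiable (by simp) _) ?_
  intro t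
  simp only [shiftedExponent, Finset.mul_sum, ← Finset.sum_add_distrib]
  refine Finset.sum_congr rfl fun a _ => ?_
  simp; ring

variable [MeasurableSpace (Matrix.unitaryGroup (Fin N) ℂ)]
  (μ : Measure (Matrix.unitaryGroup (Fin N) ℂ))

/-- The average over `U` of `G (U* Z U) exp (∑ a, x_a ((U* Z U)_aa - iB))`. -/
noncomputable def unitaryAverage (Z : Matrix (Fin N) (Fin N) ℂ) (B : ℝ)
    (G : Matrix (Fin N) (Fin N) ℂ → ℂ) (x : Fin N → ℝ) : ℂ :=
  ∫ U, G (unitaryConj Z U) * Complex.exp (shiftedExponent B x (unitaryConj Z U)) ∂μ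

variable [BorelSpace (Matrix.unitaryGroup (Fin N) ℂ)]

theorem integrable_unitaryAverage [IsFiniteMeasure μ] (Z : Matrix (Fin N) (Fin N) ℂ) (B : ℝ)
    {G : Matrix (Fin N) (Fin N) ℂ → ℂ} (hG : Continuous G) (x : Fin N → ℝ) :
    Integrable (fun U => G (unitaryConj Z U) *
      Complex.exp (shiftedExponent B x (unitaryConj Z U))) μ := by
  have hM := continuous_unitaryConj Z
  refine Continuous.integrable_of_compactSpace μ ?_
  exact (hG.comp hM).mul (Complex.continuous_exp.comp
    ((contDiff_shiftedExponent B x).continuous.comp hM))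

theorem hasFDerivAt_unitaryAverage [IsFiniteMeasure μ] (Z : Matrix (Fin N) (Fin N) ℂ) (B : ℝ)
    {G : Matrix (Fin N) (Fin N) ℂ → ℂ} (hG : Continuous G) (x : Fin N → ℝ) :
    HasFDerivAt (unitaryAverage μ Z B G)
      (∑ a, (ContinuousLinearMap.proj (R := ℝ) (φ := fun _ : Fin N => ℝ) a).smulRight
        (unitaryAverage μ Z B (fun M => (M a a - Complex.I * B) * G M) x)) x := by
  have hM := continuous_unitaryConj Z
  have hentry (a : Fin N) : Continuous fun M : Matrix (Fin N) (Fin N) ℂ => M a a :=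
    (contDiff_matrix_apply a a).continuous
  have hexp : Continuous fun p : (Fin N → ℝ) × Matrix.unitaryGroup (Fin N) ℂ =>
      Complex.exp (shiftedExponent B p.1 (unitaryConj Z p.2)) := by
    refine Complex.continuous_exp.comp ?_
    unfold shiftedExponent
    refine continuous_finsetSum _ fun a _ => ?_
    have := (hentry a).comp hM
    fun_prop
  let f (a : Fin N) (x : Fin N → ℝ) (U : Matrix.unitaryGroup (Fin N) ℂ) : ℂ :=
    ((unitaryConj Z U) a a - Complex.I * B) * G (unitaryConj Z U) *
      Complex.exp (shiftedExponent B x (unitaryConj Z U))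
  have hf (a : Fin N) : Continuous fun p : (Fin N → ℝ) × Matrix.unitaryGroup (Fin N) ℂ =>
      f a p.1 p.2 := by
    refine Continuous.mul ?_ hexp
    have h1 := (hentry a).comp hM
    have h2 := hG.comp hM
    fun_prop
  have hF' : Continuous fun p : (Fin N → ℝ) × Matrix.unitaryGroup (Fin N) ℂ =>
      ∑ a, (ContinuousLinearMap.proj (R := ℝ) (φ := fun _ : Fin N => ℝ) a).smulRight
        (f a p.1 p.2) := by
    refine continuous_finsetSum _ fun a _ => ?_
    exact (ContinuousLinearMap.smulRightL ℝ (Fin N → ℝ) ℂ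
      (ContinuousLinearMap.proj (R := ℝ) (φ := fun _ : Fin N => ℝ) a)).continuous.comp (hf a)
  have key := hasFDerivAt_integral_of_compactSpace μ
    (F := fun x U => G (unitaryConj Z U) *
      Complex.exp (shiftedExponent B x (unitaryConj Z U)))
    (F' := fun x U => ∑ a, (ContinuousLinearMap.proj (R := ℝ) (φ := fun _ : Fin N => ℝ)
      a).smulRight (f a x U)) ?_ hF' ?_ x
  · refine key.congr_fderiv (ContinuousLinearMap.ext fun v => ?_)
    symm
    rw [ContinuousLinearMap.integral_apply]
    · simp only [_root_.sum_apply, ContinuousLinearMap.smulRight_apply,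
        ContinuousLinearMap.proj_apply]
      rw [integral_finsetSum]
      · refine Finset.sum_congr rfl fun a _ => ?_
        rw [integral_smul]
        rfl
      · intro a _
        exact (Continuous.integrable_of_compactSpace μ
          ((hf a).comp (Continuous.prodMk_right x))).smul _
    · exact (hF'.comp (Continuous.prodMk_right x)).integrable_of_compactSpace μ
  · intro x
    exact (hG.comp hM).mul (hexp.comp (Continuous.prodMk_right x))
  · intro x U
    have h1 : HasFDerivAt (fun z : Fin N → ℝ => shiftedExponent B z (unitaryConj Z U))
        (∑ a, (ContinuousLinearMap.proj (R := ℝ) (φ := fun _ : Fin N => ℝ) a).smulRight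
          (unitaryConj Z U a a - Complex.I * B)) x := by
      unfold shiftedExponent
      simp only [← Complex.real_smul]
      exact HasFDerivAt.fun_sum fun a _ =>
        (hasFDerivAt_apply (𝕜 := ℝ) a x).smul_const (unitaryConj Z U a a - Complex.I * B)
    refine (h1.cexp.const_mul (G (unitaryConj Z U))).congr_fderiv
      (ContinuousLinearMap.ext fun v => ?_)
    symm
    simp only [f, _root_.sum_apply, ContinuousLinearMap.smulRight_apply,
        ContinuousLinearMap.proj_apply, smul_apply, Finset.smul_sum]
    refine Finset.sum_congr rfl fun a _ => ?_
    simp only [smul_eq_mul, Complex.real_smul]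
    ring

theorem contDiff_unitaryAverage [IsFiniteMeasure μ] (Z : Matrix (Fin N) (Fin N) ℂ) (B : ℝ)
    {G : Matrix (Fin N) (Fin N) ℂ → ℂ} (hG : Continuous G) :
    ContDiff ℝ ∞ (unitaryAverage μ Z B G) := by
  refine contDiff_infty.2 fun n => ?_
  induction n generalizing G with
  | zero =>
    exact contDiff_zero.2 (Differentiable.continuous (𝕜 := ℝ) fun x =>
      (hasFDerivAt_unitaryAverage μ Z B hG x).differentiableAt)
  | succ n ih =>
    refine (contDiff_succ_iff_hasFDerivAt (n := n)).2
      ⟨_, ?_, fun x => hasFDerivAt_unitaryAverage μ Z B hG x⟩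
    refine ContDiff.sum fun a _ => contDiff_const.smulRight (ih ?_)
    exact ((contDiff_matrix_apply a a).continuous.sub continuous_const).mul hG

theorem shiftedPartialDeriv_unitaryAverage [IsFiniteMeasure μ] (Z : Matrix (Fin N) (Fin N) ℂ)
    (B : ℝ) {G : Matrix (Fin N) (Fin N) ℂ → ℂ} (hG : Continuous G) (c : Fin N) :
    shiftedPartialDeriv B c (unitaryAverage μ Z B G) =
      unitaryAverage μ Z B (fun M => M c c * G M) := by
  ext x
  have hc : Continuous fun M : Matrix (Fin N) (Fin N) ℂ => (M c c - Complex.I * B) * G M :=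
    ((contDiff_matrix_apply c c).continuous.sub continuous_const).mul hG
  rw [shiftedPartialDeriv, (hasFDerivAt_unitaryAverage μ Z B hG x).fderiv]
  simp only [_root_.sum_apply, ContinuousLinearMap.smulRight_apply,
    ContinuousLinearMap.proj_apply, Pi.single_apply, ite_smul, one_smul, zero_smul,
    Finset.sum_ite_eq', Finset.mem_univ, if_true]
  rw [unitaryAverage, unitaryAverage, unitaryAverage, ← integral_const_mul, ← integral_add]
  · congr 1; ext U; ring
  · exact integrable_unitaryAverage μ Z B hc x
  · exact (integrable_unitaryAverage μ Z B hG x).const_mul _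

variable [μ.IsHaarMeasure] [IsProbabilityMeasure μ]

theorem unitaryAverage_mul_mixedMinor (Z : Matrix (Fin N) (Fin N) ℂ) (B : ℝ) (x : Fin N → ℝ)
    {S : Finset (Fin N)} {c a : Fin N} (hc : c ∉ S) (ha : a ∈ S) :
    ((x c : ℂ) - x a) * unitaryAverage μ Z B (fun M => M c a * mixedMinor S c a M) x =
      unitaryAverage μ Z B (fun M => (principalRows S M).det) x -
        unitaryAverage μ Z B (fun M => (principalRows (insert c (S.erase a)) M).det) x := by
  have hW := contDiff_mixedMinor S c a
  have hE := contDiff_shiftedExponent B x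
  have hΦ : ContDiff ℂ 1 fun M => mixedMinor S c a M * Complex.exp (shiftedExponent B x M) :=
    (hW.mul hE.cexp).of_le (by simp)
  have key := integral_fderiv_commutator μ hΦ Z (Matrix.single a c 1)
  have hpoint (M : Matrix (Fin N) (Fin N) ℂ) :
      fderiv ℂ (fun M => mixedMinor S c a M * Complex.exp (shiftedExponent B x M)) M
        (M * Matrix.single a c 1 - Matrix.single a c 1 * M) =
      ((x c : ℂ) - x a) * (M c a * mixedMinor S c a M * Complex.exp (shiftedExponent B x M)) -
      ((principalRows S M).det * Complex.exp (shiftedExponent B x M) -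
        (principalRows (insert c (S.erase a)) M).det *
          Complex.exp (shiftedExponent B x M)) := by
    have dW : DifferentiableAt ℂ (mixedMinor S c a) M := hW.differentiable (by simp) M
    have dE : DifferentiableAt ℂ (shiftedExponent B x) M := hE.differentiable (by simp) M
    have h1 : fderiv ℂ (mixedMinor S c a) M (M * Matrix.single a c 1) = _ :=
      fderiv_apply_of_affine dW (mixedMinor_add_mul_single hc ha M)
    have h2 : fderiv ℂ (mixedMinor S c a) M (Matrix.single a c 1 * M) = _ :=
      fderiv_apply_of_affine dW (mixedMinor_add_single_mul hc ha M)
    have h3 : fderiv ℂ (shiftedExponent B x) M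
        (M * Matrix.single a c 1 - Matrix.single a c 1 * M) = ((x c : ℂ) - x a) * M c a := by
      rw [fderiv_shiftedExponent]
      have e1 (i : Fin N) : (M * Matrix.single a c 1 : Matrix (Fin N) (Fin N) ℂ) i i =
          if i = c then M c a else 0 := by
        by_cases hi : i = c
        · subst hi; simp
        · simp [hi]
      have e2 (i : Fin N) : (Matrix.single a c 1 * M : Matrix (Fin N) (Fin N) ℂ) i i =
          if i = a then M c a else 0 := by
        by_cases hi : i = a
        · subst hi; simp
        · simp [hi]
      simp [e1, e2, mul_sub, sub_mul]
    have h4 := (map_sub (fderiv ℂ (mixedMinor S c a) M) _ _).trans (congrArg₂ (· - ·) h1 h2)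
    exact (fderiv_mul_cexp_apply dW dE h4 h3).trans (by ring)
  have cW : Continuous fun M : Matrix (Fin N) (Fin N) ℂ => M c a * mixedMinor S c a M :=
    (contDiff_matrix_apply c a).continuous.mul hW.continuous
  have i1 := integrable_unitaryAverage μ Z B cW x
  have i2 := integrable_unitaryAverage μ Z B (contDiff_det_principalRows S).continuous x
  have i3 := integrable_unitaryAverage μ Z B
    (contDiff_det_principalRows (insert c (S.erase a))).continuous x
  simp only [hpoint] at key
  rw [integral_sub (i1.const_mul _) (by exact i2.sub i3), integral_sub i2 i3,
    integral_const_mul] at key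
  exact sub_eq_zero.1 key

theorem unitaryAverage_det_principalRows_insert (Z : Matrix (Fin N) (Fin N) ℂ) (B : ℝ)
    {x : Fin N → ℝ} (hx : Function.Injective x) {S : Finset (Fin N)} {c : Fin N} (hc : c ∉ S) :
    unitaryAverage μ Z B (fun M => (principalRows (insert c S) M).det) x =
      shiftedPartialDeriv B c (unitaryAverage μ Z B fun M => (principalRows S M).det) x +
      ∑ a ∈ S, (unitaryAverage μ Z B (fun M => (principalRows S M).det) x -
        unitaryAverage μ Z B (fun M => (principalRows (insert c (S.erase a)) M).det) x) /
          ((x c : ℂ) - x a) := by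
  have hP := (contDiff_det_principalRows S).continuous
  have cW (a : Fin N) : Continuous fun M : Matrix (Fin N) (Fin N) ℂ =>
      M c a * mixedMinor S c a M :=
    (contDiff_matrix_apply c a).continuous.mul (contDiff_mixedMinor S c a).continuous
  have hterm : ∀ a ∈ S, (unitaryAverage μ Z B (fun M => (principalRows S M).det) x -
        unitaryAverage μ Z B (fun M => (principalRows (insert c (S.erase a)) M).det) x) /
          ((x c : ℂ) - x a) =
      unitaryAverage μ Z B (fun M => M c a * mixedMinor S c a M) x := by
    intro a ha
    have hne : (x c : ℂ) - x a ≠ 0 := by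
      have hca : c ≠ a := by rintro rfl; exact hc ha
      exact sub_ne_zero.2 (by exact_mod_cast hx.ne hca)
    rw [← unitaryAverage_mul_mixedMinor μ Z B x hc ha, mul_div_cancel_left₀ _ hne]
  rw [Finset.sum_congr rfl hterm, shiftedPartialDeriv_unitaryAverage μ Z B hP]
  simp only [unitaryAverage, det_principalRows_insert hc, add_mul, Finset.sum_mul]
  rw [integral_add, integral_finsetSum]
  · exact fun a _ => integrable_unitaryAverage μ Z B (cW a) x
  · exact integrable_unitaryAverage μ Z B
      ((contDiff_matrix_apply c c).continuous.mul hP) x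
  · exact integrable_finsetSum _ fun a _ => integrable_unitaryAverage μ Z B (cW a) x

end MatrixAverage

section SmoothFunctions

variable {N : ℕ}

/-- The algebra of smooth complex-valued functions of `N` real variables. -/
def smoothFunctions (N : ℕ) : Subalgebra ℂ ((Fin N → ℝ) → ℂ) where
  carrier := {f | ContDiff ℝ ∞ f}
  mul_mem' {f g} (hf : ContDiff ℝ ∞ f) (hg : ContDiff ℝ ∞ g) := hf.mul hg
  add_mem' {f g} (hf : ContDiff ℝ ∞ f) (hg : ContDiff ℝ ∞ g) := hf.add hg
  algebraMap_mem' r := (contDiff_const : ContDiff ℝ ∞ fun _ : Fin N → ℝ => r)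

instance : CoeFun (smoothFunctions N) fun _ => (Fin N → ℝ) → ℂ := ⟨Subtype.val⟩

theorem contDiff_of_smoothFunctions (f : smoothFunctions N) : ContDiff ℝ ∞ (f : (Fin N → ℝ) → ℂ) :=
  f.2

theorem differentiable_of_smoothFunctions (f : smoothFunctions N) :
    Differentiable ℝ (f : (Fin N → ℝ) → ℂ) :=
  (contDiff_of_smoothFunctions f).differentiable (by simp)

theorem dense_setOf_injective (N : ℕ) : Dense {x : Fin N → ℝ | Function.Injective x} := by
  intro x
  let γ (t : ℝ) : Fin N → ℝ := fun i => x i + t * (i : ℕ)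
  have hγ : Continuous γ := by fun_prop
  have hfin : (⋃ p : Fin N × Fin N,
      {(x p.2 - x p.1) / (((p.1 : ℕ) : ℝ) - ((p.2 : ℕ) : ℝ))}).Finite :=
    Set.finite_iUnion fun _ => Set.finite_singleton _
  have hmem : (0 : ℝ) ∈ closure _ := hfin.countable.dense_compl ℝ 0
  have himage := image_closure_subset_closure_image hγ (Set.mem_image_of_mem γ hmem)
  have h0 : γ 0 = x := by ext i; simp [γ]
  rw [h0] at himage
  refine closure_mono ?_ himage
  rintro _ ⟨t, ht, rfl⟩ i j hij
  by_contra hne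
  refine ht (Set.mem_iUnion.2 ⟨(i, j), ?_⟩)
  have hsub : ((i : ℕ) : ℝ) - ((j : ℕ) : ℝ) ≠ 0 := by
    rw [sub_ne_zero]
    exact_mod_cast fun h => hne (Fin.ext h)
  simp only [γ] at hij
  rw [Set.mem_singleton_iff, eq_div_iff hsub]
  linarith

theorem smoothFunctions_ext_of_injective {f g : smoothFunctions N}
    (h : ∀ x : Fin N → ℝ, Function.Injective x → f x = g x) : f = g :=
  Subtype.ext (Continuous.ext_on (dense_setOf_injective N)
    (contDiff_of_smoothFunctions f).continuous
    (contDiff_of_smoothFunctions g).continuous fun x hx => h x hx)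

/-- The operator `∂/∂x_c + iB` on smooth functions. -/
noncomputable def shiftedPartialDerivEnd (B : ℝ) (c : Fin N) :
    Module.End ℂ (smoothFunctions N) where
  toFun f := ⟨shiftedPartialDeriv B c f,
    (((contDiff_of_smoothFunctions f).fderiv_right (m := ∞) (by simp)).clm_apply contDiff_const).add
      (contDiff_const.mul (contDiff_of_smoothFunctions f))⟩
  map_add' f g := by
    refine Subtype.ext (funext fun x => ?_)
    have h := fderiv_add (differentiable_of_smoothFunctions f x)
      (differentiable_of_smoothFunctions g x)
    simp only [shiftedPartialDeriv, Subalgebra.coe_add, h, Pi.add_apply, add_apply]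
    ring
  map_smul' r f := by
    refine Subtype.ext (funext fun x => ?_)
    have h := fderiv_const_smul (differentiable_of_smoothFunctions f x) r
    simp only [shiftedPartialDeriv, Subalgebra.coe_smul, h, Pi.smul_apply, smul_apply,
      smul_eq_mul, RingHom.id_apply]
    ring

theorem shiftedPartialDerivEnd_apply (B : ℝ) (c : Fin N) (f : smoothFunctions N)
    (x : Fin N → ℝ) : shiftedPartialDerivEnd B c f x =
      fderiv ℝ f x (Pi.single c 1) + Complex.I * (B : ℂ) * f x :=
  rfl

theorem shiftedPartialDerivEnd_mul (B : ℝ) (c : Fin N) (h f : smoothFunctions N)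
    (x : Fin N → ℝ) : shiftedPartialDerivEnd B c (h * f) x =
      h x * shiftedPartialDerivEnd B c f x + fderiv ℝ h x (Pi.single c 1) * f x := by
  have := fderiv_mul (differentiable_of_smoothFunctions h x) (differentiable_of_smoothFunctions f x)
  simp only [shiftedPartialDerivEnd_apply, Subalgebra.coe_mul, this, Pi.mul_apply,
    add_apply, smul_apply, smul_eq_mul]
  ring

theorem shiftedPartialDerivEnd_mul_of_invariant (B : ℝ) (c : Fin N) {h : smoothFunctions N}
    (hh : ∀ x (t : ℝ), h (x + t • Pi.single c 1) = h x) (f : smoothFunctions N) :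
    shiftedPartialDerivEnd B c (h * f) = h * shiftedPartialDerivEnd B c f := by
  refine Subtype.ext (funext fun x => ?_)
  rw [shiftedPartialDerivEnd_mul, ← (differentiable_of_smoothFunctions h x).lineDeriv_eq_fderiv,
    lineDeriv]
  simp [hh]

theorem commute_shiftedPartialDerivEnd (B : ℝ) (a b : Fin N) :
    Commute (shiftedPartialDerivEnd B a) (shiftedPartialDerivEnd B b) := by
  refine LinearMap.ext fun f => Subtype.ext (funext fun x => ?_)
  have hsymm : IsSymmSndFDerivAt ℝ (f : (Fin N → ℝ) → ℂ) x :=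
    (contDiff_of_smoothFunctions f).contDiffAt.isSymmSndFDerivAt
      (by simpa using WithTop.coe_le_coe.2 (le_top : (2 : ℕ∞) ≤ ⊤))
  have hd : DifferentiableAt ℝ (fderiv ℝ (f : (Fin N → ℝ) → ℂ)) x :=
    ((contDiff_of_smoothFunctions f).fderiv_right (m := ∞) (by simp)).differentiable (by simp) x
  have key (c d : Fin N) : shiftedPartialDerivEnd B c (shiftedPartialDerivEnd B d f) x =
      fderiv ℝ (fderiv ℝ (f : (Fin N → ℝ) → ℂ)) x (Pi.single c 1) (Pi.single d 1) +
        Complex.I * B * fderiv ℝ f x (Pi.single c 1) +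
        Complex.I * B * (fderiv ℝ f x (Pi.single d 1) + Complex.I * (B : ℂ) * f x) := by
    have h := ((hd.hasFDerivAt.clm_apply (hasFDerivAt_const (Pi.single d (1 : ℝ)) x)).add
      ((differentiable_of_smoothFunctions f x).hasFDerivAt.const_mul (Complex.I * (B : ℂ)))).fderiv
    have h' := congrArg (fun L => L (Pi.single c (1 : ℝ))) h
    rw [shiftedPartialDerivEnd_apply, shiftedPartialDerivEnd_apply]
    congr 1
    refine h'.trans ?_
    simp
  simp only [Module.End.mul_apply]
  rw [key, key, hsymm.eq]
  ring

/-- The composition of the operators `∂/∂x_c + iB` for `c ∈ S`. -/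
noncomputable def sekiguchiOperator (B : ℝ) (S : Finset (Fin N)) :
    Module.End ℂ (smoothFunctions N) :=
  S.noncommProd (shiftedPartialDerivEnd B) fun a _ b _ _ => commute_shiftedPartialDerivEnd B a b

theorem sekiguchiOperator_empty (B : ℝ) : sekiguchiOperator B (∅ : Finset (Fin N)) = 1 :=
  Finset.noncommProd_empty _ _

theorem sekiguchiOperator_eq_mul_erase (B : ℝ) {S : Finset (Fin N)} {c : Fin N} (hc : c ∈ S) :
    sekiguchiOperator B S = shiftedPartialDerivEnd B c * sekiguchiOperator B (S.erase c) :=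
  (Finset.mul_noncommProd_erase S hc _ _).symm

theorem sekiguchiOperator_univ_apply (B : ℝ) (f : smoothFunctions N) :
    (sekiguchiOperator B univ f : (Fin N → ℝ) → ℂ) =
      (List.finRange N).foldr (shiftedPartialDeriv B) f := by
  have h : sekiguchiOperator B (univ : Finset (Fin N)) =
      ((List.finRange N).map (shiftedPartialDerivEnd B)).prod := by
    rw [← Finset.noncommProd_toFinset _ _
      (fun a _ b _ _ => commute_shiftedPartialDerivEnd B a b) (List.nodup_finRange N)]
    exact Finset.noncommProd_congr (by simp) (fun _ _ => rfl) _
  rw [h]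
  induction List.finRange N with
  | nil => rfl
  | cons a l ih =>
    rw [List.map_cons, List.prod_cons, Module.End.mul_apply, List.foldr_cons, ← ih]
    rfl

theorem sekiguchiOperator_mul_of_invariant (B : ℝ) {S : Finset (Fin N)} {h : smoothFunctions N}
    (hh : ∀ c ∈ S, ∀ x (t : ℝ), h (x + t • Pi.single c 1) = h x) (f : smoothFunctions N) :
    sekiguchiOperator B S (h * f) = h * sekiguchiOperator B S f := by
  induction S using Finset.induction_on with
  | empty => simp [sekiguchiOperator_empty]
  | insert c S hc ih =>
    rw [sekiguchiOperator_eq_mul_erase B (mem_insert_self c S), erase_insert hc,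
      Module.End.mul_apply, Module.End.mul_apply, ih fun a ha => hh a (mem_insert_of_mem ha),
      shiftedPartialDerivEnd_mul_of_invariant B c (hh c (mem_insert_self c S))]

theorem contDiff_ofReal_apply (c : Fin N) : ContDiff ℝ ∞ fun x : Fin N → ℝ => (x c : ℂ) :=
  Complex.ofRealCLM.contDiff.comp (contDiff_apply ℝ ℝ c)

/-- The Vandermonde determinant in the variables indexed by `S`. -/
noncomputable def vandermondeOn (S : Finset (Fin N)) : smoothFunctions N :=
  ⟨fun x => ∏ a ∈ S, ∏ b ∈ S, if a < b then ((x a : ℂ) - x b) else 1, by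
    have h (a b : Fin N) :
        ContDiff ℝ ∞ fun x : Fin N → ℝ => if a < b then ((x a : ℂ) - x b) else 1 := by
      by_cases hab : a < b
      · simpa only [if_pos hab] using (contDiff_ofReal_apply a).sub (contDiff_ofReal_apply b)
      · simpa only [if_neg hab] using contDiff_const
    exact contDiff_prod fun a _ => contDiff_prod fun b _ => h a b⟩

theorem vandermondeOn_apply (S : Finset (Fin N)) (x : Fin N → ℝ) :
    vandermondeOn S x = ∏ a ∈ S, ∏ b ∈ S, if a < b then ((x a : ℂ) - x b) else 1 :=
  rfl

theorem vandermondeOn_univ (x : Fin N → ℝ) : vandermondeOn univ x = vandermondeProd x := by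
  rw [vandermondeOn_apply, vandermondeProd]
  push_cast
  refine Finset.prod_congr rfl fun a _ => ?_
  rw [← Finset.prod_filter, Finset.filter_lt_eq_Ioi]

theorem vandermondeOn_add_single {S : Finset (Fin N)} {c : Fin N} (hc : c ∉ S) (x : Fin N → ℝ)
    (t : ℝ) : vandermondeOn S (x + t • Pi.single c 1) = vandermondeOn S x := by
  simp only [vandermondeOn_apply]
  refine Finset.prod_congr rfl fun a ha => Finset.prod_congr rfl fun b hb => ?_
  have h1 : a ≠ c := fun h => hc (h ▸ ha)
  have h2 : b ≠ c := fun h => hc (h ▸ hb)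
  simp [h1, h2]

/-- The sign relating the Vandermonde determinant in the variables indexed by `S` to the one in
the variables indexed by `S.erase c`. -/
noncomputable def vandermondeSign (S : Finset (Fin N)) (c : Fin N) : ℂ :=
  ∏ b ∈ S.erase c, if c < b then 1 else -1

theorem vandermondeOn_eq_mul_erase {S : Finset (Fin N)} {c : Fin N} (hc : c ∈ S)
    (x : Fin N → ℝ) : vandermondeOn S x =
      vandermondeSign S c * vandermondeOn (S.erase c) x *
        ∏ b ∈ S.erase c, ((x c : ℂ) - x b) := by
  have hsign : (vandermondeSign S c * ∏ b ∈ S.erase c, ((x c : ℂ) - x b)) =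
      (∏ b ∈ S.erase c, if c < b then ((x c : ℂ) - x b) else 1) *
        ∏ b ∈ S.erase c, if b < c then ((x b : ℂ) - x c) else 1 := by
    rw [vandermondeSign, ← Finset.prod_mul_distrib, ← Finset.prod_mul_distrib]
    refine Finset.prod_congr rfl fun b hb => ?_
    rcases lt_or_gt_of_ne (Finset.ne_of_mem_erase hb) with h | h
    · simp [h, h.not_gt]
    · simp [h, h.not_gt]
  rw [mul_right_comm, hsign]
  simp only [vandermondeOn_apply]
  conv_lhs => rw [← Finset.insert_erase hc]
  simp only [Finset.prod_insert (Finset.notMem_erase c S), lt_irrefl, if_false, one_mul,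
    Finset.prod_mul_distrib]
  ring

/-- A polynomial in the variable `x_c`. -/
noncomputable def coordPolynomial (P : Polynomial ℂ) (c : Fin N) : smoothFunctions N :=
  ⟨fun x => P.eval (x c : ℂ), by
    have h : ContDiff ℂ ∞ fun w : ℂ => P.eval w := by
      simpa only [Polynomial.coe_aeval_eq_eval] using P.contDiff_aeval (𝕜 := ℂ) ∞
    exact (h.restrict_scalars ℝ).comp (contDiff_ofReal_apply c)⟩

theorem coordPolynomial_apply (P : Polynomial ℂ) (c : Fin N) (x : Fin N → ℝ) :
    coordPolynomial P c x = P.eval (x c : ℂ) :=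
  rfl

theorem coordPolynomial_add_single (P : Polynomial ℂ) {a c : Fin N} (hac : a ≠ c)
    (x : Fin N → ℝ) (t : ℝ) :
    coordPolynomial P c (x + t • Pi.single a 1) = coordPolynomial P c x := by
  simp [coordPolynomial_apply, hac.symm]

theorem fderiv_coordPolynomial (P : Polynomial ℂ) (c : Fin N) (x : Fin N → ℝ) :
    fderiv ℝ (coordPolynomial P c : (Fin N → ℝ) → ℂ) x (Pi.single c 1) =
      P.derivative.eval (x c : ℂ) := by
  rw [← (differentiable_of_smoothFunctions (coordPolynomial P c) x).lineDeriv_eq_fderiv, lineDeriv]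
  have h : HasDerivAt (fun w : ℂ => P.eval ((x c : ℂ) + w)) (P.derivative.eval (x c : ℂ))
      ((0 : ℝ) : ℂ) := by
    have := P.hasDerivAt ((x c : ℂ) + ((0 : ℝ) : ℂ))
    simpa using this.comp_const_add (x c : ℂ) ((0 : ℝ) : ℂ)
  rw [← h.comp_ofReal.deriv]
  simp [coordPolynomial_apply]

theorem vandermondeOn_eq_sum_coordPolynomial {S : Finset (Fin N)} {P : Polynomial ℂ}
    (hP : P.Monic) (hdeg : (#S : WithBot ℕ) = P.degree + 1) :
    vandermondeOn S = ∑ c ∈ S,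
      vandermondeSign S c • (coordPolynomial P c * vandermondeOn (S.erase c)) := by
  refine smoothFunctions_ext_of_injective fun x hx => ?_
  have hinj : Set.InjOn (fun a => (x a : ℂ)) (S : Set (Fin N)) :=
    fun a _ b _ h => hx (Complex.ofReal_injective h)
  have hL := Lagrange.leadingCoeff_eq_sum hinj hdeg
  rw [hP.leadingCoeff] at hL
  rw [← mul_one (vandermondeOn S x), hL, Finset.mul_sum]
  simp only [AddSubmonoidClass.coe_finsetSum, Finset.sum_apply, Subalgebra.coe_smul,
    Subalgebra.coe_mul, Pi.smul_apply, Pi.mul_apply, smul_eq_mul]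
  refine Finset.sum_congr rfl fun c hc => ?_
  have hw : ∏ b ∈ S.erase c, ((x c : ℂ) - x b) ≠ 0 := by
    refine Finset.prod_ne_zero_iff.2 fun b hb => sub_ne_zero.2 ?_
    exact_mod_cast hx.ne (Finset.ne_of_mem_erase hb).symm
  rw [vandermondeOn_eq_mul_erase hc, coordPolynomial_apply]
  field_simp

/-- Functions `g S` related by the recurrence below, in which the `c`-th partial derivative of
`g S` is corrected by Dunkl-type difference quotients, are obtained from `g ∅` by conjugating the
operator `∏ c ∈ S, (∂/∂x_c + iB)` by the Vandermonde determinant. -/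
theorem sekiguchiOperator_vandermondeOn_mul (B : ℝ) {g : Finset (Fin N) → smoothFunctions N}
    (hg : ∀ (S : Finset (Fin N)) (c : Fin N), c ∉ S → ∀ x : Fin N → ℝ, Function.Injective x →
      g (insert c S) x = shiftedPartialDerivEnd B c (g S) x +
        ∑ a ∈ S, (g S x - g (insert c (S.erase a)) x) / ((x c : ℂ) - x a))
    (S : Finset (Fin N)) :
    sekiguchiOperator B S (vandermondeOn S * g ∅) = vandermondeOn S * g S := by
  induction S using Finset.strongInduction with
  | H S ih =>
  rcases S.eq_empty_or_nonempty with rfl | ⟨c₀, hc₀⟩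
  · simp [sekiguchiOperator_empty]
  refine smoothFunctions_ext_of_injective fun x hx => ?_
  let P : Polynomial ℂ := Lagrange.nodal (S.erase c₀) fun a => (x a : ℂ)
  have hdeg : (#S : WithBot ℕ) = P.degree + 1 := by
    rw [Lagrange.degree_nodal, ← Finset.card_erase_add_one hc₀]
    rfl
  have hterm (c : Fin N) (hc : c ∈ S) :
      sekiguchiOperator B S (coordPolynomial P c * vandermondeOn (S.erase c) * g ∅) x =
        vandermondeOn (S.erase c) x *
          (P.eval (x c : ℂ) * shiftedPartialDerivEnd B c (g (S.erase c)) x +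
            P.derivative.eval (x c : ℂ) * g (S.erase c) x) := by
    rw [sekiguchiOperator_eq_mul_erase B hc, Module.End.mul_apply, mul_assoc,
      sekiguchiOperator_mul_of_invariant B fun a ha =>
        coordPolynomial_add_single P (Finset.ne_of_mem_erase ha),
      ih _ (Finset.erase_ssubset hc), mul_left_comm,
      shiftedPartialDerivEnd_mul_of_invariant B c
        (vandermondeOn_add_single (Finset.notMem_erase c S)),
      Subalgebra.coe_mul, Pi.mul_apply, shiftedPartialDerivEnd_mul, fderiv_coordPolynomial,
      coordPolynomial_apply]
  have hw (c : Fin N) : ∏ b ∈ S.erase c, ((x c : ℂ) - x b) ≠ 0 := by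
    refine Finset.prod_ne_zero_iff.2 fun b hb => sub_ne_zero.2 ?_
    exact_mod_cast hx.ne (Finset.ne_of_mem_erase hb).symm
  have hsign (c : Fin N) (hc : c ∈ S) : vandermondeSign S c * vandermondeOn (S.erase c) x =
      vandermondeOn S x / ∏ b ∈ S.erase c, ((x c : ℂ) - x b) := by
    rw [eq_div_iff (hw c), vandermondeOn_eq_mul_erase hc]
  have hsum : sekiguchiOperator B S (vandermondeOn S * g ∅) x =
      ∑ c ∈ S, vandermondeOn S x / (∏ b ∈ S.erase c, ((x c : ℂ) - x b)) *
          (P.eval (x c : ℂ) * shiftedPartialDerivEnd B c (g (S.erase c)) x +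
            P.derivative.eval (x c : ℂ) * g (S.erase c) x) := by
    conv_lhs => rw [vandermondeOn_eq_sum_coordPolynomial (Lagrange.nodal_monic) hdeg]
    rw [Finset.sum_mul, map_sum]
    simp only [AddSubmonoidClass.coe_finsetSum, Finset.sum_apply]
    refine Finset.sum_congr rfl fun c hc => ?_
    rw [smul_mul_assoc, map_smul, Subalgebra.coe_smul, Pi.smul_apply, hterm c hc, smul_eq_mul,
      ← mul_assoc, hsign c hc]
  have hnode : ∀ a ∈ S.erase c₀,
      vandermondeOn S x / (∏ b ∈ S.erase a, ((x a : ℂ) - x b)) *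
          (P.eval (x a : ℂ) * shiftedPartialDerivEnd B a (g (S.erase a)) x +
            P.derivative.eval (x a : ℂ) * g (S.erase a) x) =
        vandermondeOn S x * (g (S.erase a) x / ((x a : ℂ) - x c₀)) := by
    intro a ha
    have hca : c₀ ∈ S.erase a :=
      Finset.mem_erase.2 ⟨(Finset.ne_of_mem_erase ha).symm, hc₀⟩
    have h1 : P.eval (x a : ℂ) = 0 :=
      Lagrange.eval_nodal_at_node (v := fun a => (x a : ℂ)) ha
    have h2 : P.derivative.eval (x a : ℂ) = ∏ b ∈ (S.erase a).erase c₀, ((x a : ℂ) - x b) := by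
      rw [Finset.erase_right_comm, ← Lagrange.eval_nodal (v := fun a => (x a : ℂ))]
      exact Lagrange.eval_nodal_derivative_eval_node_eq (v := fun a => (x a : ℂ)) ha
    have hprod := hw a
    rw [← Finset.mul_prod_erase _ _ hca] at hprod ⊢
    have h3 := left_ne_zero_of_mul hprod
    have h4 := right_ne_zero_of_mul hprod
    rw [h1, h2]
    field_simp
    ring
  have hc₀' : vandermondeOn S x / (∏ b ∈ S.erase c₀, ((x c₀ : ℂ) - x b)) *
          (P.eval (x c₀ : ℂ) * shiftedPartialDerivEnd B c₀ (g (S.erase c₀)) x +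
            P.derivative.eval (x c₀ : ℂ) * g (S.erase c₀) x) =
        vandermondeOn S x * (shiftedPartialDerivEnd B c₀ (g (S.erase c₀)) x +
          ∑ a ∈ S.erase c₀, g (S.erase c₀) x / ((x c₀ : ℂ) - x a)) := by
    have h1 : P.eval (x c₀ : ℂ) = ∏ b ∈ S.erase c₀, ((x c₀ : ℂ) - x b) := Lagrange.eval_nodal
    have h2 : P.derivative.eval (x c₀ : ℂ) = (∏ b ∈ S.erase c₀, ((x c₀ : ℂ) - x b)) *
        ∑ a ∈ S.erase c₀, 1 / ((x c₀ : ℂ) - x a) := by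
      rw [Lagrange.derivative_nodal, Polynomial.eval_finsetSum, Finset.mul_sum]
      refine Finset.sum_congr rfl fun a ha => ?_
      have hprod := hw c₀
      rw [← Finset.mul_prod_erase _ _ ha] at hprod ⊢
      have h3 := left_ne_zero_of_mul hprod
      rw [Lagrange.eval_nodal]
      field_simp
    have h5 := hw c₀
    have h6 : ∑ a ∈ S.erase c₀, g (S.erase c₀) x / ((x c₀ : ℂ) - x a) =
        (∑ a ∈ S.erase c₀, 1 / ((x c₀ : ℂ) - x a)) * g (S.erase c₀) x := by
      rw [Finset.sum_mul]
      exact Finset.sum_congr rfl fun a _ => by ring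
    rw [h1, h2, h6]
    field_simp
  have hrec := hg (S.erase c₀) c₀ (Finset.notMem_erase c₀ S) x hx
  rw [Finset.insert_erase hc₀] at hrec
  rw [hsum, ← Finset.add_sum_erase _ _ hc₀, Finset.sum_congr rfl hnode, hc₀',
    Subalgebra.coe_mul, Pi.mul_apply, hrec, ← Finset.mul_sum, ← mul_add, add_assoc,
    ← Finset.sum_add_distrib]
  congr 2
  refine Finset.sum_congr rfl fun a ha => ?_
  have hne := Finset.ne_of_mem_erase ha
  have hins : insert c₀ ((S.erase c₀).erase a) = S.erase a := by
    rw [Finset.erase_right_comm, Finset.insert_erase (Finset.mem_erase.2 ⟨hne.symm, hc₀⟩)]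
  rw [hins, ← neg_sub (x c₀ : ℂ), div_neg]
  ring

end SmoothFunctions

section MatrixBessel

variable {N : ℕ}

theorem shiftedExponent_unitaryConj_diagonal (B : ℝ) (y x : Fin N → ℝ)
    (U : Matrix.unitaryGroup (Fin N) ℂ) :
    shiftedExponent B x
        (unitaryConj (Matrix.diagonal fun a => Complex.I * ((y a : ℂ) + B)) U) =
      Complex.I * (Matrix.diagonal (fun a => (y a : ℂ)) * (U : Matrix (Fin N) (Fin N) ℂ) *
        Matrix.diagonal (fun a => (x a : ℂ)) * star (U : Matrix (Fin N) (Fin N) ℂ)).trace := by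
  have hZ : (Matrix.diagonal fun a => Complex.I * ((y a : ℂ) + B)) =
      Complex.I • Matrix.diagonal (fun a => (y a : ℂ)) +
        (Complex.I * B) • (1 : Matrix (Fin N) (Fin N) ℂ) := by
    ext i j
    by_cases hij : i = j
    · subst hij; simp [mul_add]
    · simp [hij]
  have hconj : unitaryConj (Matrix.diagonal fun a => Complex.I * ((y a : ℂ) + B)) U =
      Complex.I • (star (U : Matrix (Fin N) (Fin N) ℂ) *
        (Matrix.diagonal (fun a => (y a : ℂ)) * (U : Matrix (Fin N) (Fin N) ℂ))) +
        (Complex.I * B) • (1 : Matrix (Fin N) (Fin N) ℂ) := by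
    rw [unitaryConj, hZ, mul_add, add_mul, mul_smul_comm, smul_mul_assoc, mul_smul_comm,
      smul_mul_assoc, mul_one, Matrix.UnitaryGroup.star_mul_self, mul_assoc]
  rw [mul_assoc _ (Matrix.diagonal fun a => (x a : ℂ)), Matrix.trace_mul_comm, mul_assoc, hconj,
    shiftedExponent, Matrix.trace, Finset.mul_sum]
  refine Finset.sum_congr rfl fun a _ => ?_
  rw [Matrix.diag_apply, Matrix.diagonal_mul, Matrix.add_apply, Matrix.smul_apply,
    Matrix.smul_apply, Matrix.one_apply_eq, smul_eq_mul, smul_eq_mul]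
  ring

variable [MeasurableSpace (Matrix.unitaryGroup (Fin N) ℂ)]
  (μ : Measure (Matrix.unitaryGroup (Fin N) ℂ))

theorem unitaryAverage_det_principalRows_empty (B : ℝ) (y x : Fin N → ℝ) :
    unitaryAverage μ (Matrix.diagonal fun a => Complex.I * ((y a : ℂ) + B)) B
      (fun M => (principalRows ∅ M).det) x = matrixBessel N μ y x := by
  have h (M : Matrix (Fin N) (Fin N) ℂ) : principalRows ∅ M = 1 := by
    ext i j
    simp [principalRows, Matrix.one_apply, Pi.single_apply, eq_comm]
  simp only [unitaryAverage, matrixBessel, h, Matrix.det_one, one_mul,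
    shiftedExponent_unitaryConj_diagonal]

theorem unitaryAverage_det_principalRows_univ (B : ℝ) (y x : Fin N → ℝ) :
    unitaryAverage μ (Matrix.diagonal fun a => Complex.I * ((y a : ℂ) + B)) B
      (fun M => (principalRows univ M).det) x =
        (∏ a, Complex.I * ((y a : ℂ) + B)) * matrixBessel N μ y x := by
  have h (M : Matrix (Fin N) (Fin N) ℂ) : principalRows univ M = M := by
    ext i j
    simp [principalRows]
  have hdet (Z : Matrix (Fin N) (Fin N) ℂ) (U : Matrix.unitaryGroup (Fin N) ℂ) :
      (unitaryConj Z U).det = Z.det := by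
    rw [unitaryConj, Matrix.det_mul_right_comm, Matrix.UnitaryGroup.star_mul_self, one_mul]
  simp only [unitaryAverage, matrixBessel, h, hdet, Matrix.det_diagonal,
    shiftedExponent_unitaryConj_diagonal, integral_const_mul]

end MatrixBessel

/-- Statement B.1 of the paper (unitary case β = 2, Eq. (B.10)): the matrix Bessel function
satisfies `[∏_a (∂/∂x_a + iB)] (Δ_N(x) φ(y,x)) = (∏_a i(y_a + B)) Δ_N(x) φ(y,x)`. -/
theorem matrix_bessel_eigenoperator (N : ℕ) (hN : 1 ≤ N)
    [MeasurableSpace (Matrix.unitaryGroup (Fin N) ℂ)]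
    [BorelSpace (Matrix.unitaryGroup (Fin N) ℂ)]
    (μ : Measure (Matrix.unitaryGroup (Fin N) ℂ))
    [μ.IsHaarMeasure] [IsProbabilityMeasure μ]
    (B : ℝ) (y : Fin N → ℝ) (x : Fin N → ℝ) :
    (List.finRange N).foldr (shiftedPartialDeriv B)
        (fun z => (vandermondeProd z : ℂ) * matrixBessel N μ y z) x
      = (∏ a : Fin N, Complex.I * ((y a : ℂ) + (B : ℂ))) *
        ((vandermondeProd x : ℂ) * matrixBessel N μ y x) := by
  let Z : Matrix (Fin N) (Fin N) ℂ := Matrix.diagonal fun a => Complex.I * ((y a : ℂ) + B)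
  let g (S : Finset (Fin N)) : smoothFunctions N :=
    ⟨unitaryAverage μ Z B fun M => (principalRows S M).det,
      contDiff_unitaryAverage μ Z B (contDiff_det_principalRows S).continuous⟩
  have h0 (z : Fin N → ℝ) : g ∅ z = matrixBessel N μ y z :=
    unitaryAverage_det_principalRows_empty μ B y z
  have h1 : g univ x = (∏ a, Complex.I * ((y a : ℂ) + B)) * matrixBessel N μ y x :=
    unitaryAverage_det_principalRows_univ μ B y x
  have key := sekiguchiOperator_vandermondeOn_mul B (g := g)
    (fun S c hc x hx => unitaryAverage_det_principalRows_insert μ Z B hx hc) univ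
  have hfun : (fun z => (vandermondeProd z : ℂ) * matrixBessel N μ y z) =
      ((vandermondeOn univ * g ∅ : smoothFunctions N) : (Fin N → ℝ) → ℂ) := by
    ext z
    rw [Subalgebra.coe_mul, Pi.mul_apply, h0, vandermondeOn_univ]
  rw [hfun, ← sekiguchiOperator_univ_apply, key, Subalgebra.coe_mul, Pi.mul_apply,
    vandermondeOn_univ, h1]
  ring
end

section
/- Let n ≥ 1 and let f : Herm(n) → ℂ be integrable with respect to d[H] and invariant under conjugation by unitary matrices, i.e. f(UHU*) = f(H) for every H ∈ Herm(n) and every unitary U. Then ∫_{Herm(n)} f(H) d[H] = g_n · ∫_{ℝ^n} f(diag(E_1,…,E_n)) · (∏_{1≤a<b≤n} (E_a − E_b))² dE, where g_n = (1/n!) · ∏_{j=1}^{n} π^{j−1}/Γ(j). -/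
open Finset MeasureTheory

/-- The index set of entries strictly above the diagonal of an `n × n` matrix. -/
abbrev UpperIdx (n : ℕ) := { p : Fin n × Fin n // p.1 < p.2 }

/-- The complex Hermitian matrix with diagonal entries `dg`, and real and imaginary parts
`re`, `im` of the entries above the diagonal. Integrating a function of this matrix over
Lebesgue measure in the coordinates `(dg, re, im)` realizes the flat measure `d[H]`
on `Herm(n)`. -/
noncomputable def hermOf {n : ℕ} (dg : Fin n → ℝ) (re im : UpperIdx n → ℝ) :
    Matrix (Fin n) (Fin n) ℂ :=
  Matrix.of fun i j =>
    if h : i < j then (re ⟨(i, j), h⟩ : ℂ) + (im ⟨(i, j), h⟩ : ℂ) * Complex.I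
    else if h' : j < i then (re ⟨(j, i), h'⟩ : ℂ) - (im ⟨(j, i), h'⟩ : ℂ) * Complex.I
    else (dg i : ℂ)

open MvPolynomial in
/-- The derivation of `ℂ[y₀, y₁, …]` sending `y_k` to `k y_{k-1+m}`. -/
noncomputable def loopDerivation (m : ℕ) :
    Derivation ℂ (MvPolynomial ℕ ℂ) (MvPolynomial ℕ ℂ) :=
  mkDerivation ℂ fun k => (k : MvPolynomial ℕ ℂ) * X (k - 1 + m)

open MvPolynomial in
/-- The operator `y_{m+1} P ↦ ∑_{a+b=m-1} y_a y_b P + ∂_m P` appearing in the loop equations. -/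
noncomputable def loopOperator (m : ℕ) (P : MvPolynomial ℕ ℂ) : MvPolynomial ℕ ℂ :=
  (∑ a ∈ range m, X a * X (m - 1 - a)) * P + loopDerivation m P

/-- The span of the monomials `y_{k₁} ⋯ y_{k_r}` with `∑ (2 k_i + 1) ≤ N`. -/
noncomputable def loopFiltration (N : ℕ) : Submodule ℂ (MvPolynomial ℕ ℂ) :=
  Submodule.span ℂ {P | ∃ l : List ℕ, (l.map fun k => 2 * k + 1).sum ≤ N ∧
    P = (l.map MvPolynomial.X).prod}

theorem loopFiltration_mono {M N : ℕ} (h : M ≤ N) : loopFiltration M ≤ loopFiltration N :=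
  Submodule.span_mono fun _ ⟨l, hl, e⟩ => ⟨l, hl.trans h, e⟩

theorem X_mul_mem_loopFiltration {N : ℕ} (k : ℕ) {P : MvPolynomial ℕ ℂ}
    (hP : P ∈ loopFiltration N) : MvPolynomial.X k * P ∈ loopFiltration (2 * k + 1 + N) := by
  induction hP using Submodule.span_induction with
  | mem x hx =>
    obtain ⟨l, hl, rfl⟩ := hx
    refine Submodule.subset_span ⟨k :: l, ?_, ?_⟩
    · simpa using hl
    · simp
  | zero => simp
  | add x y _ _ hx hy => rw [mul_add]; exact add_mem hx hy
  | smul a x _ hx => rw [mul_smul_comm]; exact Submodule.smul_mem _ _ hx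

theorem loopDerivation_mem_loopFiltration (m : ℕ) (l : List ℕ) :
    loopDerivation m (l.map MvPolynomial.X).prod ∈
      loopFiltration ((l.map fun k => 2 * k + 1).sum + 2 * m) := by
  induction l with
  | nil => simp
  | cons k l ih =>
    simp only [List.map_cons, List.prod_cons, List.sum_cons, Derivation.leibniz, smul_eq_mul]
    refine add_mem ?_ ?_
    · exact loopFiltration_mono (by omega) (X_mul_mem_loopFiltration k ih)
    · rw [loopDerivation, MvPolynomial.mkDerivation_X]
      have h1 : ((l.map MvPolynomial.X).prod : MvPolynomial ℕ ℂ) ∈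
          loopFiltration (l.map fun k => 2 * k + 1).sum :=
        Submodule.subset_span ⟨l, le_rfl, rfl⟩
      have h2 := X_mul_mem_loopFiltration (k - 1 + m) h1
      rcases Nat.eq_zero_or_pos k with rfl | hk
      · simp
      have h3 : (l.map MvPolynomial.X).prod * ((k : MvPolynomial ℕ ℂ) * MvPolynomial.X (k - 1 + m))
          = (k : ℂ) • (MvPolynomial.X (k - 1 + m) * (l.map MvPolynomial.X).prod) := by
        rw [MvPolynomial.smul_eq_C_mul]; simp; ring
      rw [h3]
      exact Submodule.smul_mem _ _ (loopFiltration_mono (by omega) h2)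

/-- A linear functional satisfying the loop equations is determined by its value at `1`. -/
theorem eq_zero_of_loopEquations (Φ : MvPolynomial ℕ ℂ →ₗ[ℂ] ℂ) (c : ℂ)
    (h0 : ∀ P, Φ (MvPolynomial.X 0 * P) = c * Φ P)
    (hloop : ∀ m P, Φ (MvPolynomial.X (m + 1) * P) = Φ (loopOperator m P))
    (h1 : Φ 1 = 0) : Φ = 0 := by
  have key : ∀ N, ∀ l : List ℕ, (l.map fun k => 2 * k + 1).sum ≤ N →
      Φ (l.map MvPolynomial.X).prod = 0 := by
    intro N
    induction N with
    | zero =>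
      intro l hl
      cases l with
      | nil => simpa using h1
      | cons k l => simp at hl
    | succ N ih =>
      have hker : ∀ P ∈ loopFiltration N, Φ P = 0 := by
        intro P hP
        have : loopFiltration N ≤ LinearMap.ker Φ := by
          refine Submodule.span_le.2 ?_
          rintro _ ⟨l, hl, rfl⟩
          exact ih l hl
        exact this hP
      intro l hl
      cases l with
      | nil => simpa using h1
      | cons k l =>
        simp only [List.map_cons, List.prod_cons, List.sum_cons] at hl ⊢
        have hl' : ((l.map MvPolynomial.X).prod : MvPolynomial ℕ ℂ) ∈
            loopFiltration (l.map fun k => 2 * k + 1).sum :=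
          Submodule.subset_span ⟨l, le_rfl, rfl⟩
        cases k with
        | zero => rw [h0, hker _ (loopFiltration_mono (by omega) hl'), mul_zero]
        | succ m =>
          rw [hloop]
          refine hker _ (add_mem ?_ ?_)
          · rw [sum_mul]
            refine sum_mem fun a ha => ?_
            rw [mem_range] at ha
            rw [mul_assoc]
            exact loopFiltration_mono (by omega)
              (X_mul_mem_loopFiltration a (X_mul_mem_loopFiltration (m - 1 - a) hl'))
          · exact loopFiltration_mono (by omega) (loopDerivation_mem_loopFiltration m l)
  have key' : ∀ P : MvPolynomial ℕ ℂ, ∀ l : List ℕ, Φ (P * (l.map MvPolynomial.X).prod) = 0 := by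
    intro P
    induction P using MvPolynomial.induction_on with
    | C a => intro l; rw [← MvPolynomial.smul_eq_C_mul, map_smul, key _ l le_rfl, smul_zero]
    | add p q hp hq => intro l; rw [add_mul, map_add, hp, hq, add_zero]
    | mul_X p i hp => intro l; simpa [mul_assoc] using hp (i :: l)
  exact LinearMap.ext fun P => by simpa using key' P []

/-- Every symmetric polynomial over `ℂ` is a polynomial in the power sums. -/
theorem exists_aeval_psum_eq {n : ℕ} (s : MvPolynomial (Fin n) ℂ) (hs : s.IsSymmetric) :
    ∃ P : MvPolynomial ℕ ℂ, MvPolynomial.aeval (MvPolynomial.psum (Fin n) ℂ) P = s := by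
  set R : Subalgebra ℂ (MvPolynomial (Fin n) ℂ) :=
    (MvPolynomial.aeval (R := ℂ) (MvPolynomial.psum (Fin n) ℂ)).range with hR
  have hp : ∀ k, MvPolynomial.psum (Fin n) ℂ k ∈ R := fun k => ⟨MvPolynomial.X k, by simp⟩
  have he : ∀ k, MvPolynomial.esymm (Fin n) ℂ k ∈ R := by
    intro k
    induction k using Nat.strong_induction_on with
    | _ k ih =>
      rcases Nat.eq_zero_or_pos k with rfl | hk
      · rw [MvPolynomial.esymm_zero]; exact one_mem R
      have h := MvPolynomial.mul_esymm_eq_sum (Fin n) ℂ k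
      have h2 : (k : MvPolynomial (Fin n) ℂ) * MvPolynomial.esymm (Fin n) ℂ k ∈ R := by
        rw [h]
        refine mul_mem (pow_mem (neg_mem (one_mem R)) _) (sum_mem fun a ha => ?_)
        exact mul_mem (mul_mem (pow_mem (neg_mem (one_mem R)) _) (ih _ (mem_filter.1 ha).2)) (hp _)
      have h3 : MvPolynomial.esymm (Fin n) ℂ k
          = (k : ℂ)⁻¹ • ((k : MvPolynomial (Fin n) ℂ) * MvPolynomial.esymm (Fin n) ℂ k) := by
        rw [MvPolynomial.smul_eq_C_mul, ← mul_assoc]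
        have : (k : MvPolynomial (Fin n) ℂ) = MvPolynomial.C (k : ℂ) := by simp
        rw [this, ← MvPolynomial.C_mul, inv_mul_cancel₀ (by exact_mod_cast hk.ne')]
        simp
      rw [h3]
      exact R.smul_mem h2 _
  obtain ⟨q, hq⟩ := MvPolynomial.esymmAlgHom_surjective (σ := Fin n) (R := ℂ) (n := n) (by simp)
    ⟨s, hs⟩
  have hq' := congrArg Subtype.val hq
  rw [MvPolynomial.esymmAlgHom_apply] at hq'
  have hmem : ∀ q : MvPolynomial (Fin n) ℂ,
      MvPolynomial.aeval (fun i : Fin n => MvPolynomial.esymm (Fin n) ℂ (i + 1)) q ∈ R := by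
    intro q
    induction q using MvPolynomial.induction_on with
    | C a => simpa using R.algebraMap_mem a
    | add p q hp hq => rw [map_add]; exact add_mem hp hq
    | mul_X p i hp => rw [map_mul, MvPolynomial.aeval_X]; exact mul_mem hp (he _)
  have hsR := hmem q
  rwa [hq'] at hsR

theorem mkDerivation_eq_sum_pderiv {σ : Type*} [Fintype σ] (f : σ → MvPolynomial σ ℂ)
    (q : MvPolynomial σ ℂ) :
    MvPolynomial.mkDerivation ℂ f q = ∑ s, f s * MvPolynomial.pderiv s q := by
  classical
  induction q using MvPolynomial.induction_on with
  | C a => simp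
  | add p q hp hq => simp [hp, hq, mul_add, sum_add_distrib]
  | mul_X p i hp =>
    simp only [Derivation.leibniz, hp, MvPolynomial.mkDerivation_X, MvPolynomial.pderiv_X,
      smul_eq_mul, mul_add, sum_add_distrib]
    congr 1
    · simp [Pi.single_apply, mul_comm]
    · rw [mul_sum]; exact sum_congr rfl fun s _ => by ring

theorem sum_pderiv_mul_eq {σ : Type*} [Fintype σ] (f : σ → MvPolynomial σ ℂ)
    (q : MvPolynomial σ ℂ) :
    ∑ s, MvPolynomial.pderiv s (f s * q)
      = (∑ s, MvPolynomial.pderiv s (f s)) * q + MvPolynomial.mkDerivation ℂ f q := by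
  simp only [mkDerivation_eq_sum_pderiv, Derivation.leibniz, smul_eq_mul, sum_add_distrib, sum_mul]
  rw [add_comm]
  simp [mul_comm]

/-- To intertwine a derivation with `loopDerivation` it suffices to do so on generators. -/
theorem derivation_aeval_eq {A : Type*} [CommRing A] [Algebra ℂ A] (D : Derivation ℂ A A)
    (t : ℕ → A) (m : ℕ) (h : ∀ k, D (t k) = k * t (k - 1 + m)) (P : MvPolynomial ℕ ℂ) :
    D (MvPolynomial.aeval t P) = MvPolynomial.aeval t (loopDerivation m P) := by
  induction P using MvPolynomial.induction_on with
  | C a => simp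
  | add p q hp hq => simp [hp, hq]
  | mul_X p i hp =>
    simp only [map_mul, Derivation.leibniz, hp, MvPolynomial.aeval_X, h, smul_eq_mul, map_add]
    simp [loopDerivation]

theorem matrix_map_derivation_mul {A ι : Type*} [CommRing A] [Algebra ℂ A] [Fintype ι]
    (D : Derivation ℂ A A) (M N : Matrix ι ι A) :
    (M * N).map D = M.map D * N + M * N.map D := by
  ext i j
  simp only [Matrix.map_apply, Matrix.mul_apply, Matrix.add_apply, map_sum, Derivation.leibniz,
    smul_eq_mul, sum_add_distrib]
  rw [add_comm]
  simp [mul_comm]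

theorem matrix_map_derivation_pow {A ι : Type*} [CommRing A] [Algebra ℂ A] [Fintype ι]
    [DecidableEq ι] (D : Derivation ℂ A A) (M : Matrix ι ι A) (m : ℕ) :
    (M ^ m).map D = ∑ a ∈ range m, M ^ a * M.map D * M ^ (m - 1 - a) := by
  induction m with
  | zero => ext i j; by_cases h : i = j <;> simp [h]
  | succ m ih =>
    rw [pow_succ, matrix_map_derivation_mul, ih, sum_range_succ, sum_mul]
    congr 1
    · refine sum_congr rfl fun a ha => ?_
      rw [mem_range] at ha
      rw [mul_assoc, ← pow_succ]
      congr 2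
      omega
    · simp

theorem derivation_trace_pow {A ι : Type*} [CommRing A] [Algebra ℂ A] [Fintype ι]
    [DecidableEq ι] (D : Derivation ℂ A A) (M : Matrix ι ι A) (k : ℕ) :
    D (M ^ k).trace = k * (M ^ (k - 1) * M.map D).trace := by
  have h : D (M ^ k).trace = ((M ^ k).map D).trace := by simp [Matrix.trace]
  rw [h, matrix_map_derivation_pow, Matrix.trace_sum]
  have : ∀ a ∈ range k, (M ^ a * M.map D * M ^ (k - 1 - a)).trace
      = (M ^ (k - 1) * M.map D).trace := by
    intro a ha
    rw [mem_range] at ha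
    rw [Matrix.trace_mul_comm, ← mul_assoc, ← pow_add]
    congr 3
    omega
  rw [sum_congr rfl this]
  simp

/-- The generic matrix has traces of powers satisfying the algebraic form of the loop equations. -/
theorem sum_pderiv_generic_matrix {n : ℕ} (m : ℕ) (P : MvPolynomial ℕ ℂ) :
    ∑ s : Fin n × Fin n, MvPolynomial.pderiv s
      ((Matrix.mvPolynomialX (Fin n) (Fin n) ℂ ^ m) s.1 s.2 *
        MvPolynomial.aeval
          (fun k => (Matrix.mvPolynomialX (Fin n) (Fin n) ℂ ^ k).trace) P)
      = MvPolynomial.aeval (fun k => (Matrix.mvPolynomialX (Fin n) (Fin n) ℂ ^ k).trace)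
          (loopOperator m P) := by
  rw [sum_pderiv_mul_eq (fun s : Fin n × Fin n =>
    (Matrix.mvPolynomialX (Fin n) (Fin n) ℂ ^ m) s.1 s.2)]
  rw [loopOperator, map_add, map_mul]
  set M := Matrix.mvPolynomialX (Fin n) (Fin n) ℂ with hM
  congr 1
  · congr 1
    have h1 : ∀ s : Fin n × Fin n, M.map (MvPolynomial.pderiv s) = Matrix.single s.1 s.2 1 := by
      intro s
      ext i j : 2
      simp only [Matrix.map_apply, hM, Matrix.mvPolynomialX_apply, MvPolynomial.pderiv_X,
        Matrix.single_apply, Pi.single_apply, Prod.ext_iff]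
      grind
    have h2 : ∀ s : Fin n × Fin n, MvPolynomial.pderiv s ((M ^ m) s.1 s.2)
        = ∑ a ∈ range m, (M ^ a) s.1 s.1 * (M ^ (m - 1 - a)) s.2 s.2 := by
      intro s
      rw [← Matrix.map_apply (f := MvPolynomial.pderiv s), matrix_map_derivation_pow, h1,
        Matrix.sum_apply]
      refine sum_congr rfl fun a _ => ?_
      rw [Matrix.mul_apply, sum_eq_single s.2]
      · simp
      · intro b _ hb
        rw [Matrix.mul_single_apply_of_ne _ _ _ _ _ hb, zero_mul]
      · simp
    rw [sum_congr rfl fun s _ => h2 s, sum_comm]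
    simp only [map_sum, map_mul, MvPolynomial.aeval_X, Matrix.trace, Matrix.diag_apply,
      sum_mul_sum, Fintype.sum_prod_type]
  · refine derivation_aeval_eq _ _ m (fun k => ?_) P
    rw [derivation_trace_pow]
    congr 2
    rw [pow_add]
    congr 1
    ext i j : 2
    rw [Matrix.map_apply, hM, Matrix.mvPolynomialX_apply, MvPolynomial.mkDerivation_X]

open MvPolynomial in
/-- The Vandermonde product as a multivariate polynomial. -/
noncomputable def vandermondePoly (n : ℕ) : MvPolynomial (Fin n) ℂ :=
  ∏ a : Fin n, ∏ b ∈ Ioi a, (X a - X b)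

/-- Logarithmic derivatives add up along finite products. -/
theorem derivation_prod_of_eq_mul {A ι : Type*} [CommRing A] [Algebra ℂ A] (D : Derivation ℂ A A)
    (s : Finset ι) (f g : ι → A) (h : ∀ i ∈ s, D (f i) = f i * g i) :
    D (∏ i ∈ s, f i) = (∏ i ∈ s, f i) * ∑ i ∈ s, g i := by
  classical
  induction s using Finset.induction_on with
  | empty => simp
  | insert a s ha ih =>
    rw [prod_insert ha, sum_insert ha, Derivation.leibniz,
      ih fun i hi => h i (mem_insert_of_mem hi), h a (mem_insert_self _ _)]
    simp only [smul_eq_mul]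
    ring

theorem derivation_vandermondePoly {n : ℕ} (m : ℕ) :
    MvPolynomial.mkDerivation ℂ (fun i : Fin n => (MvPolynomial.X i : MvPolynomial (Fin n) ℂ) ^ m)
      (vandermondePoly n) = vandermondePoly n * ∑ a : Fin n, ∑ b ∈ Ioi a, ∑ k ∈ range m,
        (MvPolynomial.X a : MvPolynomial (Fin n) ℂ) ^ k * MvPolynomial.X b ^ (m - 1 - k) := by
  refine derivation_prod_of_eq_mul _ _ _ _ fun a _ =>
    derivation_prod_of_eq_mul _ _ _ _ fun b _ => ?_
  rw [map_sub, MvPolynomial.mkDerivation_X, MvPolynomial.mkDerivation_X, mul_comm]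
  exact ((Commute.all _ _).geom_sum₂_mul m).symm

theorem sum_pderiv_vandermonde {n : ℕ} (m : ℕ) (P : MvPolynomial ℕ ℂ) :
    ∑ i : Fin n, MvPolynomial.pderiv i
      (MvPolynomial.X i ^ m * (MvPolynomial.aeval (MvPolynomial.psum (Fin n) ℂ) P *
        vandermondePoly n ^ 2))
      = MvPolynomial.aeval (MvPolynomial.psum (Fin n) ℂ) (loopOperator m P) *
          vandermondePoly n ^ 2 := by
  rw [sum_pderiv_mul_eq (fun i : Fin n => (MvPolynomial.X i : MvPolynomial (Fin n) ℂ) ^ m)]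
  have hD := derivation_vandermondePoly (n := n) m
  set D := MvPolynomial.mkDerivation ℂ
    (fun i : Fin n => (MvPolynomial.X i : MvPolynomial (Fin n) ℂ) ^ m) with hDdef
  have hDP : D (MvPolynomial.aeval (MvPolynomial.psum (Fin n) ℂ) P)
      = MvPolynomial.aeval (MvPolynomial.psum (Fin n) ℂ) (loopDerivation m P) := by
    refine derivation_aeval_eq _ _ m (fun k => ?_) P
    simp only [MvPolynomial.psum, map_sum, Derivation.leibniz_pow, hDdef,
      MvPolynomial.mkDerivation_X, smul_eq_mul, mul_sum, pow_add, nsmul_eq_mul]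
  have hsym : 2 * (∑ a : Fin n, ∑ b ∈ Ioi a, ∑ k ∈ range m,
        (MvPolynomial.X a : MvPolynomial (Fin n) ℂ) ^ k * MvPolynomial.X b ^ (m - 1 - k))
      + ∑ i : Fin n, MvPolynomial.pderiv i (MvPolynomial.X i ^ m)
      = ∑ k ∈ range m, MvPolynomial.psum (Fin n) ℂ k * MvPolynomial.psum (Fin n) ℂ (m - 1 - k) := by
    set h : Fin n → Fin n → MvPolynomial (Fin n) ℂ := fun a b => ∑ k ∈ range m,
        (MvPolynomial.X a : MvPolynomial (Fin n) ℂ) ^ k * MvPolynomial.X b ^ (m - 1 - k) with hh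
    have hcomm : ∀ a b, h a b = h b a := by
      intro a b
      rw [hh]
      simp only
      rw [← sum_range_reflect]
      refine sum_congr rfl fun k hk => ?_
      rw [mem_range] at hk
      rw [mul_comm]
      congr 2
      omega
    have hdiag : ∀ i : Fin n, MvPolynomial.pderiv i
        ((MvPolynomial.X i : MvPolynomial (Fin n) ℂ) ^ m) = h i i := by
      intro i
      have : ∀ k ∈ range m, (MvPolynomial.X i : MvPolynomial (Fin n) ℂ) ^ k *
          MvPolynomial.X i ^ (m - 1 - k) = MvPolynomial.X i ^ (m - 1) := by
        intro k hk
        rw [mem_range] at hk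
        rw [← pow_add]
        congr 1
        omega
      rw [hh]
      simp only
      rw [sum_congr rfl this]
      simp [Derivation.leibniz_pow]
    have htot : ∑ k ∈ range m, MvPolynomial.psum (Fin n) ℂ k *
        MvPolynomial.psum (Fin n) ℂ (m - 1 - k) = ∑ a, ∑ b, h a b := by
      simp only [MvPolynomial.psum, sum_mul_sum, hh]
      rw [sum_comm]
      refine sum_congr rfl fun a _ => ?_
      rw [sum_comm]
    rw [htot, sum_congr rfl fun i _ => hdiag i]
    have hlow : ∑ a : Fin n, ∑ b ∈ Iio a, h a b = ∑ a : Fin n, ∑ b ∈ Ioi a, h a b := by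
      rw [sum_comm' (t' := univ) (s' := fun b => Ioi b) (by simp)]
      exact sum_congr rfl fun a _ => sum_congr rfl fun b _ => hcomm _ _
    have hsplit : ∀ a : Fin n, ∑ b, h a b
        = ∑ b ∈ Ioi a, h a b + ∑ b ∈ Iio a, h a b + h a a := by
      intro a
      rw [← sum_erase_add univ _ (mem_univ a), ← sum_union]
      · congr 2
        ext b
        simp only [mem_erase, mem_univ, and_true, mem_union, mem_Ioi, mem_Iio]
        omega
      · rw [disjoint_left]
        intro b hb hb'
        rw [mem_Ioi] at hb
        rw [mem_Iio] at hb'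
        omega
    rw [sum_congr rfl fun a _ => hsplit a, sum_add_distrib, sum_add_distrib, hlow]
    ring
  rw [Derivation.leibniz, Derivation.leibniz_pow, hDP, hD, loopOperator, map_add, map_mul]
  simp only [map_sum, map_mul, MvPolynomial.aeval_X, smul_eq_mul, nsmul_eq_mul]
  rw [← hsym]
  push_cast
  ring

section GaussianWeight

variable {V : Type*} [NormedAddCommGroup V] [NormedSpace ℝ V]

/-- Continuous functions of at most exponential growth. -/
def ExpBounded (g : V → ℂ) : Prop :=
  Continuous g ∧ ∃ A K : ℝ, ∀ x, ‖g x‖ ≤ A * Real.exp (K * ‖x‖)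

/-- Continuous weights with Gaussian decay. -/
def IsGaussianWeight (w : V → ℝ) : Prop :=
  Continuous w ∧ ∃ c : ℝ, 0 < c ∧ ∀ x, |w x| ≤ Real.exp (-c * ‖x‖ ^ 2)

omit [NormedSpace ℝ V] in
theorem ExpBounded.const (c : ℂ) : ExpBounded (fun _ : V => c) :=
  ⟨continuous_const, ‖c‖, 0, by simp⟩

omit [NormedSpace ℝ V] in
theorem ExpBounded.exists_nonneg {g : V → ℂ} (hg : ExpBounded g) :
    ∃ A K : ℝ, 0 ≤ A ∧ 0 ≤ K ∧ ∀ x, ‖g x‖ ≤ A * Real.exp (K * ‖x‖) := by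
  obtain ⟨_, A, K, h⟩ := hg
  refine ⟨|A|, |K|, abs_nonneg _, abs_nonneg _, fun x => (h x).trans ?_⟩
  gcongr
  · exact le_abs_self A
  · exact le_abs_self K

omit [NormedSpace ℝ V] in
theorem ExpBounded.add {f g : V → ℂ} (hf : ExpBounded f) (hg : ExpBounded g) :
    ExpBounded (fun x => f x + g x) := by
  obtain ⟨A, K, hA, hK, h⟩ := hf.exists_nonneg
  obtain ⟨A', K', hA', hK', h'⟩ := hg.exists_nonneg
  refine ⟨hf.1.add hg.1, A + A', K + K', fun x => (norm_add_le _ _).trans ?_⟩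
  rw [add_mul]
  refine add_le_add ((h x).trans ?_) ((h' x).trans ?_)
  · gcongr; linarith
  · gcongr; linarith

omit [NormedSpace ℝ V] in
theorem ExpBounded.mul {f g : V → ℂ} (hf : ExpBounded f) (hg : ExpBounded g) :
    ExpBounded (fun x => f x * g x) := by
  obtain ⟨A, K, hA, hK, h⟩ := hf.exists_nonneg
  obtain ⟨A', K', hA', hK', h'⟩ := hg.exists_nonneg
  refine ⟨hf.1.mul hg.1, A * A', K + K', fun x => ?_⟩
  rw [norm_mul, add_mul, Real.exp_add]
  calc ‖f x‖ * ‖g x‖ ≤ (A * Real.exp (K * ‖x‖)) * (A' * Real.exp (K' * ‖x‖)) := by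
        gcongr
        · exact h x
        · exact h' x
    _ = _ := by ring

theorem ExpBounded.clm (ℓ : V →L[ℝ] ℂ) : ExpBounded (fun x => ℓ x) := by
  refine ⟨ℓ.continuous, ‖ℓ‖, 1, fun x => (ℓ.le_opNorm x).trans ?_⟩
  gcongr
  rw [one_mul]
  linarith [Real.add_one_le_exp ‖x‖]

theorem ExpBounded.eval {σ : Type*} (ℓ : σ → V →L[ℝ] ℂ) (q : MvPolynomial σ ℂ) :
    ExpBounded (fun x => MvPolynomial.eval (fun s => ℓ s x) q) := by
  induction q using MvPolynomial.induction_on with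
  | C a => simpa using ExpBounded.const a
  | add p q hp hq => simpa using hp.add hq
  | mul_X p i hp => simpa using hp.mul (ExpBounded.clm (ℓ i))

variable [FiniteDimensional ℝ V] [MeasurableSpace V] [BorelSpace V] {μ : Measure V}
  [μ.IsAddHaarMeasure]

theorem ExpBounded.integrable_mul {g : V → ℂ} (hg : ExpBounded g) {w : V → ℝ}
    (hw : IsGaussianWeight w) : Integrable (fun x => g x * (w x : ℂ)) μ := by
  obtain ⟨A, K, hA, hK, h⟩ := hg.exists_nonneg
  obtain ⟨hwc, c, hc, hwb⟩ := hw
  set d := Module.finrank ℝ V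
  set L : ℝ := K + (d + 1)
  have hint := integrable_one_add_norm (E := V) (μ := μ) (r := (d : ℝ) + 1) (by simp [d])
  refine (hint.const_mul (A * Real.exp (L ^ 2 / (4 * c)))).mono'
    (hg.1.mul (Complex.continuous_ofReal.comp hwc)).aestronglyMeasurable (.of_forall fun x => ?_)
  rw [norm_mul, Complex.norm_real, Real.norm_eq_abs]
  have hpos : 0 < 1 + ‖x‖ := by positivity
  have h1 : (Real.exp (-((d + 1) * ‖x‖))) ≤ (1 + ‖x‖) ^ (-((d : ℝ) + 1)) := by
    rw [Real.rpow_def_of_pos hpos]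
    apply Real.exp_le_exp.2
    have := Real.log_le_sub_one_of_pos hpos
    have h0 : (0 : ℝ) ≤ d + 1 := by positivity
    nlinarith
  calc ‖g x‖ * |w x| ≤ (A * Real.exp (K * ‖x‖)) * Real.exp (-c * ‖x‖ ^ 2) := by
        gcongr
        · exact h x
        · exact hwb x
    _ = A * Real.exp (K * ‖x‖ - c * ‖x‖ ^ 2) := by
        rw [mul_assoc, ← Real.exp_add]; congr 2; ring
    _ ≤ A * Real.exp (L ^ 2 / (4 * c) - (d + 1) * ‖x‖) := by
        refine mul_le_mul_of_nonneg_left (Real.exp_le_exp.2 ?_) hA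
        have : L ^ 2 / (4 * c) - L * ‖x‖ + c * ‖x‖ ^ 2 = (L - 2 * c * ‖x‖) ^ 2 / (4 * c) := by
          field_simp
          ring
        have h2 : 0 ≤ (L - 2 * c * ‖x‖) ^ 2 / (4 * c) := by positivity
        simp only [L] at *
        nlinarith
    _ = A * Real.exp (L ^ 2 / (4 * c)) * Real.exp (-((d + 1) * ‖x‖)) := by
        rw [mul_assoc, ← Real.exp_add]; congr 2
    _ ≤ _ := by gcongr

omit [FiniteDimensional ℝ V] [MeasurableSpace V] [BorelSpace V] in
theorem hasLineDerivAt_eval {σ : Type*} [Fintype σ] (ℓ : σ → V →L[ℝ] ℂ)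
    (q : MvPolynomial σ ℂ) (x v : V) :
    HasLineDerivAt ℝ (fun x => MvPolynomial.eval (fun s => ℓ s x) q)
      (∑ s, ℓ s v * MvPolynomial.eval (fun s => ℓ s x) (MvPolynomial.pderiv s q)) x v := by
  classical
  induction q using MvPolynomial.induction_on with
  | C a => simpa [HasLineDerivAt] using hasDerivAt_const (0 : ℝ) a
  | add p q hp hq =>
    have h := HasDerivAt.add hp hq
    simp only [HasLineDerivAt, map_add, mul_add, sum_add_distrib]
    simp only [map_add] at h
    exact h
  | mul_X p i hp =>
    have hX : HasDerivAt (fun t : ℝ => ℓ i (x + t • v)) (ℓ i v) 0 := by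
      simpa using (hasDerivAt_id (0 : ℝ)).smul_const (ℓ i v) |>.const_add (ℓ i x)
    have := HasDerivAt.mul hp hX
    simp only [HasLineDerivAt, map_mul, MvPolynomial.eval_X]
    refine this.congr_deriv ?_
    simp only [zero_smul, add_zero, Derivation.leibniz, MvPolynomial.pderiv_X, smul_eq_mul, map_add,
      map_mul, MvPolynomial.eval_X, mul_add, sum_add_distrib, Pi.single_apply, sum_mul]
    rw [add_comm]
    congr 1
    · simp [apply_ite, mul_comm]
    · exact sum_congr rfl fun s _ => by ring

/-- Integration by parts for polynomials against a Gaussian weight. -/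
theorem gaussian_integration_by_parts {σ : Type*} [Fintype σ] (ℓ : σ → V →L[ℝ] ℂ) {w : V → ℝ}
    (hw : IsGaussianWeight w) (v : V) (b : MvPolynomial σ ℂ)
    (hd : ∀ x, HasLineDerivAt ℝ (fun x => (w x : ℂ))
      (-(MvPolynomial.eval (fun s => ℓ s x) b * w x)) x v) (q : MvPolynomial σ ℂ) :
    ∑ s, ℓ s v * ∫ x, MvPolynomial.eval (fun s => ℓ s x) (MvPolynomial.pderiv s q) * (w x : ℂ) ∂μ
      = ∫ x, MvPolynomial.eval (fun s => ℓ s x) (q * b) * (w x : ℂ) ∂μ := by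
  have hI : ∀ q : MvPolynomial σ ℂ,
      Integrable (fun x => MvPolynomial.eval (fun s => ℓ s x) q * (w x : ℂ)) μ := fun q =>
    (ExpBounded.eval ℓ q).integrable_mul hw
  have hsum : ∀ x, (∑ s, ℓ s v * MvPolynomial.eval (fun s => ℓ s x) (MvPolynomial.pderiv s q))
        * (w x : ℂ) = ∑ s, ℓ s v *
          (MvPolynomial.eval (fun s => ℓ s x) (MvPolynomial.pderiv s q) * (w x : ℂ)) := by
    intro x
    rw [sum_mul]
    exact sum_congr rfl fun s _ => by ring
  have h := integral_bilinear_hasLineDerivAt_right_eq_neg_left_of_integrable (μ := μ) (v := v)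
    (f := fun x => MvPolynomial.eval (fun s => ℓ s x) q) (g := fun x => (w x : ℂ))
    (f' := fun x => ∑ s, ℓ s v * MvPolynomial.eval (fun s => ℓ s x) (MvPolynomial.pderiv s q))
    (g' := fun x => -(MvPolynomial.eval (fun s => ℓ s x) b * w x))
    (B := ContinuousLinearMap.mul ℝ ℂ)
    (by
      simp only [ContinuousLinearMap.mul_apply', hsum]
      exact integrable_finsetSum _ fun s _ => (hI _).const_mul _)
    (by
      simp only [ContinuousLinearMap.mul_apply', mul_neg, ← mul_assoc, ← map_mul]
      exact (hI _).neg)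
    (by simpa using hI q)
    (fun x _ => hasLineDerivAt_eval ℓ q x v) (fun x _ => hd x)
  simp only [ContinuousLinearMap.mul_apply', mul_neg, integral_neg, neg_inj, hsum] at h
  simp only [← mul_assoc, ← map_mul] at h
  rw [h]
  simp only [mul_assoc]
  rw [integral_finsetSum _ fun s _ => (hI _).const_mul _]
  simp only [integral_const_mul]

end GaussianWeight

section GaussianFunctional

variable {V : Type*} [NormedAddCommGroup V] [NormedSpace ℝ V]
  [FiniteDimensional ℝ V] [MeasurableSpace V] [BorelSpace V]

/-- Integration of polynomials in the linear forms `ℓ` against the weight `w`. -/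
noncomputable def gaussianFunctional {σ : Type*} (μ : Measure V) [μ.IsAddHaarMeasure]
    (ℓ : σ → V →L[ℝ] ℂ) {w : V → ℝ} (hw : IsGaussianWeight w) : MvPolynomial σ ℂ →ₗ[ℂ] ℂ where
  toFun q := ∫ x, MvPolynomial.eval (fun s => ℓ s x) q * (w x : ℂ) ∂μ
  map_add' p q := by
    simp only [map_add, add_mul]
    exact integral_add ((ExpBounded.eval ℓ p).integrable_mul hw)
      ((ExpBounded.eval ℓ q).integrable_mul hw)
  map_smul' c p := by
    simp only [MvPolynomial.smul_eval, mul_assoc, integral_const_mul, RingHom.id_apply, smul_eq_mul]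

end GaussianFunctional

/-- The standard Gaussian weight on eigenvalue space. -/
noncomputable def eigenWeight {n : ℕ} (E : Fin n → ℝ) : ℝ := Real.exp (-(∑ i, E i ^ 2) / 2)

/-- The complex-valued coordinate functions on eigenvalue space. -/
noncomputable def eigenCoord {n : ℕ} (i : Fin n) : (Fin n → ℝ) →L[ℝ] ℂ :=
  Complex.ofRealCLM.comp (ContinuousLinearMap.proj i)

@[simp] theorem eigenCoord_apply {n : ℕ} (i : Fin n) (E : Fin n → ℝ) :
    eigenCoord i E = (E i : ℂ) := rfl

theorem norm_sq_le_sum_sq {ι : Type*} [Fintype ι] (E : ι → ℝ) : ‖E‖ ^ 2 ≤ ∑ i, E i ^ 2 := by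
  have h : ‖E‖ ≤ Real.sqrt (∑ i, E i ^ 2) := by
    refine (pi_norm_le_iff_of_nonneg (Real.sqrt_nonneg _)).2 fun i => ?_
    rw [Real.norm_eq_abs, ← Real.sqrt_sq_eq_abs]
    exact Real.sqrt_le_sqrt (single_le_sum (f := fun i => E i ^ 2) (fun _ _ => sq_nonneg _)
      (mem_univ i))
  calc ‖E‖ ^ 2 ≤ Real.sqrt (∑ i, E i ^ 2) ^ 2 := by gcongr
    _ = _ := Real.sq_sqrt (sum_nonneg fun _ _ => sq_nonneg _)

theorem isGaussianWeight_eigenWeight (n : ℕ) : IsGaussianWeight (eigenWeight (n := n)) := by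
  refine ⟨by unfold eigenWeight; fun_prop, 1 / 2, by norm_num, fun E => ?_⟩
  rw [eigenWeight, abs_of_pos (Real.exp_pos _)]
  apply Real.exp_le_exp.2
  linarith [norm_sq_le_sum_sq E]

/-- Gaussian weights `exp (-B(x,x)/2)` have the expected line derivatives. -/
theorem hasLineDerivAt_exp_quadratic {V : Type*} [AddCommGroup V] [Module ℝ V]
    (B : V →ₗ[ℝ] V →ₗ[ℝ] ℝ) (hB : ∀ x y, B x y = B y x) (x v : V) :
    HasLineDerivAt ℝ (fun x => ((Real.exp (-(B x x) / 2) : ℝ) : ℂ))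
      (-((B v x : ℝ) * (Real.exp (-(B x x) / 2) : ℝ) : ℂ)) x v := by
  have h : HasDerivAt (fun t : ℝ => Real.exp (-(B x x + 2 * t * B v x + t ^ 2 * B v v) / 2))
      (Real.exp (-(B x x + 2 * 0 * B v x + 0 ^ 2 * B v v) / 2) *
        (-((2 * 1 * B v x + (2 * 0 ^ 1 * 1) * B v v)) / 2)) 0 := by
    refine HasDerivAt.exp (HasDerivAt.div_const (HasDerivAt.neg ?_) 2)
    refine HasDerivAt.add (HasDerivAt.const_add _ ?_) ?_
    · exact ((hasDerivAt_id (0 : ℝ)).const_mul 2).mul_const _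
    · simpa using (((hasDerivAt_id (0 : ℝ)).pow 2).mul_const (B v v))
  have h' := h.ofReal_comp
  have heq : (fun t : ℝ => ((Real.exp (-(B (x + t • v) (x + t • v)) / 2) : ℝ) : ℂ))
      = fun t : ℝ => ((Real.exp (-(B x x + 2 * t * B v x + t ^ 2 * B v v) / 2) : ℝ) : ℂ) := by
    ext t
    congr 4
    simp only [map_add, map_smul, LinearMap.add_apply, LinearMap.smul_apply, smul_eq_mul, hB x v]
    ring
  rw [HasLineDerivAt, heq]
  refine h'.congr_deriv ?_
  rw [← Complex.ofReal_mul, ← Complex.ofReal_neg]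
  congr 1
  simp
  ring

/-- The integral of polynomials against `Δ(E)² exp(-|E|²/2)`. -/
noncomputable def eigenFunctional (n : ℕ) : MvPolynomial ℕ ℂ →ₗ[ℂ] ℂ :=
  (gaussianFunctional volume (eigenCoord (n := n)) (isGaussianWeight_eigenWeight n)).comp
    ((LinearMap.mulRight ℂ (vandermondePoly n ^ 2)).comp
      (MvPolynomial.aeval (MvPolynomial.psum (Fin n) ℂ)).toLinearMap)

theorem eigen_integration_by_parts {n : ℕ} (i : Fin n) (q : MvPolynomial (Fin n) ℂ) :
    gaussianFunctional volume eigenCoord (isGaussianWeight_eigenWeight n)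
        (MvPolynomial.pderiv i q)
      = gaussianFunctional volume eigenCoord (isGaussianWeight_eigenWeight n)
        (q * MvPolynomial.X i) := by
  let B : (Fin n → ℝ) →ₗ[ℝ] (Fin n → ℝ) →ₗ[ℝ] ℝ := dotProductBilin ℝ ℝ
  have hBd : ∀ x y, B x y = x ⬝ᵥ y := fun _ _ => rfl
  have hW : ∀ x, eigenWeight x = Real.exp (-(B x x) / 2) := by
    intro x; simp only [eigenWeight, hBd, dotProduct, sq]
  have h := gaussian_integration_by_parts (μ := volume) eigenCoord (isGaussianWeight_eigenWeight n)
    (Pi.single i 1) (MvPolynomial.X i) (fun x => by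
      have := hasLineDerivAt_exp_quadratic B (fun x y => dotProduct_comm x y) x (Pi.single i 1)
      simp only [← hW] at this
      rw [hBd, single_dotProduct, one_mul] at this
      simpa using this) q
  simp only [eigenCoord_apply, Pi.single_apply] at h
  simpa [gaussianFunctional, apply_ite] using h

theorem eigenFunctional_loop {n : ℕ} (m : ℕ) (P : MvPolynomial ℕ ℂ) :
    eigenFunctional n (MvPolynomial.X (m + 1) * P) = eigenFunctional n (loopOperator m P) := by
  simp only [eigenFunctional, LinearMap.comp_apply, AlgHom.toLinearMap_apply,
    LinearMap.mulRight_apply]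
  rw [← sum_pderiv_vandermonde, map_sum]
  simp only [eigen_integration_by_parts]
  rw [← map_sum, map_mul (MvPolynomial.aeval _), MvPolynomial.aeval_X, MvPolynomial.psum, sum_mul,
    sum_mul]
  refine congrArg _ ?_
  exact sum_congr rfl fun i _ => by ring

/-- Splitting a double sum into its diagonal and off-diagonal parts. -/
theorem sum_sum_eq_diag_add_upper {n : ℕ} {M : Type*} [AddCommMonoid M] (F : Fin n → Fin n → M) :
    ∑ i, ∑ j, F i j = ∑ i, F i i + ∑ p : UpperIdx n, (F p.1.1 p.1.2 + F p.1.2 p.1.1) := by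
  have h1 : ∑ p : UpperIdx n, F p.1.1 p.1.2 = ∑ i, ∑ j ∈ Ioi i, F i j := by
    rw [← sum_subtype (univ.filter fun p : Fin n × Fin n => p.1 < p.2) (by simp)
      (fun p : Fin n × Fin n => F p.1 p.2), sum_filter, Fintype.sum_prod_type]
    refine sum_congr rfl fun i _ => ?_
    rw [← sum_filter]
    congr 1
    ext; simp
  have h2 : ∑ p : UpperIdx n, F p.1.2 p.1.1 = ∑ i, ∑ j ∈ Iio i, F i j := by
    rw [← sum_subtype (univ.filter fun p : Fin n × Fin n => p.1 < p.2) (by simp)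
      (fun p : Fin n × Fin n => F p.2 p.1), sum_filter, Fintype.sum_prod_type, sum_comm]
    refine sum_congr rfl fun i _ => ?_
    rw [← sum_filter]
    congr 1
    ext; simp
  rw [sum_add_distrib, h1, h2, ← sum_add_distrib, ← sum_add_distrib]
  refine sum_congr rfl fun a _ => ?_
  rw [← add_sum_erase univ _ (mem_univ a), ← sum_union]
  · congr 2
    ext b
    simp only [mem_erase, mem_univ, and_true, mem_union, mem_Ioi, mem_Iio]
    omega
  · rw [disjoint_left]
    intro b hb hb'
    rw [mem_Ioi] at hb
    rw [mem_Iio] at hb'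
    omega

/-- The real coordinate space of Hermitian matrices. -/
abbrev HermCoord (n : ℕ) := (Fin n → ℝ) × (UpperIdx n → ℝ) × (UpperIdx n → ℝ)

/-- The linear parametrization of Hermitian matrices by their real coordinates. -/
noncomputable def herm (n : ℕ) : HermCoord n →ₗ[ℝ] Matrix (Fin n) (Fin n) ℂ where
  toFun x := hermOf x.1 x.2.1 x.2.2
  map_add' x y := by
    ext i j
    simp only [hermOf, Matrix.of_apply, Matrix.add_apply, Prod.fst_add, Prod.snd_add, Pi.add_apply]
    split_ifs <;> push_cast <;> ring
  map_smul' c x := by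
    ext i j
    simp only [hermOf, Matrix.of_apply, Matrix.smul_apply, Prod.smul_fst, Prod.smul_snd,
      Pi.smul_apply, smul_eq_mul, RingHom.id_apply, Complex.real_smul]
    split_ifs <;> push_cast <;> ring

theorem herm_apply {n : ℕ} (x : HermCoord n) : herm n x = hermOf x.1 x.2.1 x.2.2 := rfl

theorem herm_diag {n : ℕ} (x : HermCoord n) (i : Fin n) : herm n x i i = (x.1 i : ℂ) := by
  simp [herm_apply, hermOf]

theorem herm_upper {n : ℕ} (x : HermCoord n) (p : UpperIdx n) :
    herm n x p.1.1 p.1.2 = (x.2.1 p : ℂ) + (x.2.2 p : ℂ) * Complex.I := by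
  simp [herm_apply, hermOf, p.2]

theorem herm_lower {n : ℕ} (x : HermCoord n) (p : UpperIdx n) :
    herm n x p.1.2 p.1.1 = (x.2.1 p : ℂ) - (x.2.2 p : ℂ) * Complex.I := by
  simp [herm_apply, hermOf, p.2, p.2.not_gt]

theorem herm_isHermitian {n : ℕ} (x : HermCoord n) : (herm n x).IsHermitian := by
  ext i j
  rw [Matrix.conjTranspose_apply]
  rcases lt_trichotomy i j with h | rfl | h
  · rw [herm_upper x ⟨(i, j), h⟩, herm_lower x ⟨(i, j), h⟩]
    simp
  · simp [herm_diag]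
  · rw [herm_upper x ⟨(j, i), h⟩, herm_lower x ⟨(j, i), h⟩]
    simp
    ring

/-- The real coordinates of (the upper triangular part of) a matrix. -/
noncomputable def hermCoords {n : ℕ} (M : Matrix (Fin n) (Fin n) ℂ) : HermCoord n :=
  (fun i => (M i i).re, fun p => (M p.1.1 p.1.2).re, fun p => (M p.1.1 p.1.2).im)

theorem hermCoords_herm {n : ℕ} (x : HermCoord n) : hermCoords (herm n x) = x := by
  refine Prod.ext ?_ (Prod.ext ?_ ?_) <;> ext p <;>
    simp [hermCoords, herm_diag, herm_upper]

theorem herm_hermCoords {n : ℕ} {M : Matrix (Fin n) (Fin n) ℂ} (hM : M.IsHermitian) :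
    herm n (hermCoords M) = M := by
  ext i j
  rcases lt_trichotomy i j with h | rfl | h
  · rw [herm_upper _ ⟨(i, j), h⟩]
    simp [hermCoords, Complex.re_add_im]
  · rw [herm_diag]
    simpa [hermCoords] using hM.coe_re_apply_self i
  · rw [herm_lower _ ⟨(j, i), h⟩, ← hM.apply i j]
    simp [hermCoords, Complex.ext_iff]

theorem continuous_hermCoords {n : ℕ} : Continuous (hermCoords (n := n)) := by
  unfold hermCoords
  have h : ∀ i j : Fin n, Continuous fun M : Matrix (Fin n) (Fin n) ℂ => M i j :=
    fun i j => continuous_id.matrix_elem i j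
  refine Continuous.prodMk (continuous_pi fun i => Complex.continuous_re.comp (h _ _))
    (Continuous.prodMk (continuous_pi fun p => Complex.continuous_re.comp (h _ _))
      (continuous_pi fun p => Complex.continuous_im.comp (h _ _)))

/-- The entries of a Hermitian matrix as linear forms in its real coordinates. -/
noncomputable def hermEntry {n : ℕ} (s : Fin n × Fin n) : HermCoord n →L[ℝ] ℂ :=
  LinearMap.toContinuousLinearMap
    (Matrix.entryLinearMap ℝ ℂ s.1 s.2 ∘ₗ herm n)

@[simp] theorem hermEntry_apply {n : ℕ} (s : Fin n × Fin n) (x : HermCoord n) :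
    hermEntry s x = herm n x s.1 s.2 := rfl

theorem continuous_herm (n : ℕ) : Continuous (herm n) :=
  continuous_matrix fun i j => (hermEntry (i, j)).continuous

/-- The trace form in real coordinates. -/
noncomputable def traceForm (n : ℕ) : HermCoord n →ₗ[ℝ] HermCoord n →ₗ[ℝ] ℝ :=
  LinearMap.mk₂ ℝ
    (fun x y => x.1 ⬝ᵥ y.1 + (2 * (x.2.1 ⬝ᵥ y.2.1) + 2 * (x.2.2 ⬝ᵥ y.2.2)))
    (by intros; simp [add_dotProduct]; ring) (by intros; simp; ring)
    (by intros; simp [dotProduct_add]; ring) (by intros; simp; ring)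

theorem traceForm_apply {n : ℕ} (x y : HermCoord n) : traceForm n x y
    = x.1 ⬝ᵥ y.1 + (2 * (x.2.1 ⬝ᵥ y.2.1) + 2 * (x.2.2 ⬝ᵥ y.2.2)) := rfl

theorem trace_herm_mul_herm {n : ℕ} (x y : HermCoord n) :
    (herm n x * herm n y).trace = (traceForm n x y : ℂ) := by
  simp only [Matrix.trace, Matrix.diag_apply, Matrix.mul_apply]
  rw [sum_sum_eq_diag_add_upper]
  simp only [herm_diag, herm_upper, herm_lower, traceForm_apply, dotProduct]
  push_cast
  rw [mul_sum, mul_sum, ← sum_add_distrib]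
  congr 1
  refine sum_congr rfl fun p _ => ?_
  linear_combination (-2 * (x.2.2 p : ℂ) * (y.2.2 p)) * Complex.I_mul_I

theorem traceForm_comm {n : ℕ} (x y : HermCoord n) : traceForm n x y = traceForm n y x := by
  simp only [traceForm_apply, dotProduct_comm]

theorem traceForm_self {n : ℕ} (x : HermCoord n) : traceForm n x x
    = ∑ i, x.1 i ^ 2 + (2 * ∑ p, x.2.1 p ^ 2 + 2 * ∑ p, x.2.2 p ^ 2) := by
  simp only [traceForm_apply, dotProduct, sq]

theorem norm_sq_le_traceForm {n : ℕ} (x : HermCoord n) : ‖x‖ ^ 2 ≤ traceForm n x x := by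
  rw [traceForm_self]
  have h1 := norm_sq_le_sum_sq x.1
  have h2 := norm_sq_le_sum_sq x.2.1
  have h3 := norm_sq_le_sum_sq x.2.2
  have h4 := sq_nonneg ‖x.1‖
  have h5 := sq_nonneg ‖x.2.1‖
  have h6 := sq_nonneg ‖x.2.2‖
  rw [Prod.norm_def, Prod.norm_def]
  rcases max_choice ‖x.1‖ (max ‖x.2.1‖ ‖x.2.2‖) with h | h <;> rw [h]
  · linarith
  · rcases max_choice ‖x.2.1‖ ‖x.2.2‖ with h | h <;> rw [h] <;> linarith

theorem exists_traceForm_le (n : ℕ) :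
    ∃ K : ℝ, 0 ≤ K ∧ ∀ x : HermCoord n, traceForm n x x ≤ K ^ 2 * ‖x‖ ^ 2 := by
  have key : ∀ {ι : Type} [Fintype ι] (y : ι → ℝ) (r : ℝ), ‖y‖ ≤ r →
      ∑ i, y i ^ 2 ≤ Fintype.card ι * r ^ 2 := by
    intro ι _ y r hr
    rw [← nsmul_eq_mul, ← card_univ]
    refine sum_le_card_nsmul _ _ _ fun i _ => ?_
    rw [← sq_abs, ← Real.norm_eq_abs]
    have := (norm_le_pi_norm y i).trans hr
    gcongr
  refine ⟨(n : ℝ) + 4 * ((Fintype.card (UpperIdx n) : ℕ) : ℝ) + 1, by positivity, fun x => ?_⟩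
  rw [traceForm_self]
  have h1 := key x.1 ‖x‖ (norm_fst_le x)
  have h2 := key x.2.1 ‖x‖ ((norm_fst_le x.2).trans (norm_snd_le x))
  have h3 := key x.2.2 ‖x‖ ((norm_snd_le x.2).trans (norm_snd_le x))
  rw [Fintype.card_fin] at h1
  set c : ℝ := ((Fintype.card (UpperIdx n) : ℕ) : ℝ)
  have hc : 0 ≤ c := by positivity
  have hn : (0 : ℝ) ≤ n := by positivity
  have : (n + 4 * c) ≤ (n + 4 * c + 1) ^ 2 := by nlinarith
  calc _ ≤ (n + 4 * c) * ‖x‖ ^ 2 := by linarith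
    _ ≤ _ := by gcongr

/-- The Gaussian weight `exp (-tr H² / 2)`. -/
noncomputable def hermWeight {n : ℕ} (x : HermCoord n) : ℝ := Real.exp (-(traceForm n x x) / 2)

theorem isGaussianWeight_hermWeight (n : ℕ) : IsGaussianWeight (hermWeight (n := n)) := by
  refine ⟨?_, 1 / 2, by norm_num, fun x => ?_⟩
  · unfold hermWeight
    simp only [traceForm_self]
    fun_prop
  rw [hermWeight, abs_of_pos (Real.exp_pos _)]
  apply Real.exp_le_exp.2
  linarith [norm_sq_le_traceForm x]

instance (n : ℕ) : (volume : Measure (HermCoord n)).IsAddHaarMeasure :=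
  have : ((volume : Measure (UpperIdx n → ℝ)).prod
      (volume : Measure (UpperIdx n → ℝ))).IsAddHaarMeasure :=
    Measure.prod.instIsAddHaarMeasure _ _
  Measure.prod.instIsAddHaarMeasure _ _

theorem herm_integration_by_parts {n : ℕ} (s : Fin n × Fin n)
    (q : MvPolynomial (Fin n × Fin n) ℂ) :
    gaussianFunctional volume hermEntry (isGaussianWeight_hermWeight n) (MvPolynomial.pderiv s q)
      = gaussianFunctional volume hermEntry (isGaussianWeight_hermWeight n)
        (q * MvPolynomial.X s.swap) := by
  set T : Fin n × Fin n → ℂ := fun s =>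
    gaussianFunctional volume hermEntry (isGaussianWeight_hermWeight n) (MvPolynomial.pderiv s q)
      - gaussianFunctional volume hermEntry (isGaussianWeight_hermWeight n)
        (q * MvPolynomial.X s.swap) with hT
  have h0 : ∀ v : HermCoord n, ∑ s : Fin n × Fin n, herm n v s.1 s.2 * T s = 0 := by
    intro v
    have hb : ∀ x, MvPolynomial.eval (fun s => hermEntry s x)
        (∑ s : Fin n × Fin n, herm n v s.1 s.2 • MvPolynomial.X s.swap)
        = (traceForm n v x : ℂ) := by
      intro x
      rw [← trace_herm_mul_herm]
      simp [Fintype.sum_prod_type, Matrix.trace, Matrix.mul_apply, MvPolynomial.smul_eval]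
    have h := gaussian_integration_by_parts (μ := volume) hermEntry (isGaussianWeight_hermWeight n)
      v (∑ s : Fin n × Fin n, herm n v s.1 s.2 • MvPolynomial.X s.swap) (fun x => by
        rw [hb]
        exact hasLineDerivAt_exp_quadratic (traceForm n) traceForm_comm x v) q
    have h' : ∑ s : Fin n × Fin n, herm n v s.1 s.2 *
        gaussianFunctional volume hermEntry (isGaussianWeight_hermWeight n)
          (MvPolynomial.pderiv s q) = gaussianFunctional volume hermEntry
        (isGaussianWeight_hermWeight n)
          (q * ∑ s : Fin n × Fin n, herm n v s.1 s.2 • MvPolynomial.X s.swap) := h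
    simp only [mul_sum, mul_smul_comm, map_sum, map_smul, smul_eq_mul] at h'
    simp only [hT, mul_sub, sum_sub_distrib, h', sub_self]
  have h1 : ∀ M : Matrix (Fin n) (Fin n) ℂ, M.IsHermitian →
      ∑ s : Fin n × Fin n, M s.1 s.2 * T s = 0 := fun M hM => by
    simpa only [herm_hermCoords hM] using h0 (hermCoords M)
  have h2 : ∀ M : Matrix (Fin n) (Fin n) ℂ, ∑ s : Fin n × Fin n, M s.1 s.2 * T s = 0 := by
    intro M
    have hre := h1 (realPart M : Matrix (Fin n) (Fin n) ℂ) (realPart M).2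
    have him := h1 (imaginaryPart M : Matrix (Fin n) (Fin n) ℂ) (imaginaryPart M).2
    have hM := realPart_add_I_smul_imaginaryPart M
    have : ∀ s : Fin n × Fin n, M s.1 s.2 * T s
        = (realPart M : Matrix (Fin n) (Fin n) ℂ) s.1 s.2 * T s + Complex.I *
          ((imaginaryPart M : Matrix (Fin n) (Fin n) ℂ) s.1 s.2 * T s) := by
      intro s
      conv_lhs => rw [← hM]
      rw [Matrix.add_apply, Matrix.smul_apply, smul_eq_mul]
      ring
    rw [sum_congr rfl fun s _ => this s, sum_add_distrib, ← mul_sum, hre, him]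
    simp
  have h3 := h2 (Matrix.single s.1 s.2 1)
  rw [sum_eq_single_of_mem s (mem_univ s)] at h3
  · simpa [hT, sub_eq_zero] using h3
  · intro t _ ht
    rw [Matrix.single_apply, if_neg, zero_mul]
    rintro ⟨ha, hb⟩
    exact ht (Prod.ext ha.symm hb.symm)

/-- The integral of polynomials in `tr H^k` against `exp (-tr H² / 2)`. -/
noncomputable def hermFunctional (n : ℕ) : MvPolynomial ℕ ℂ →ₗ[ℂ] ℂ :=
  (gaussianFunctional volume (hermEntry (n := n)) (isGaussianWeight_hermWeight n)).comp
    (MvPolynomial.aeval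
      (fun k => (Matrix.mvPolynomialX (Fin n) (Fin n) ℂ ^ k).trace)).toLinearMap

theorem hermFunctional_loop {n : ℕ} (m : ℕ) (P : MvPolynomial ℕ ℂ) :
    hermFunctional n (MvPolynomial.X (m + 1) * P) = hermFunctional n (loopOperator m P) := by
  simp only [hermFunctional, LinearMap.comp_apply, AlgHom.toLinearMap_apply]
  rw [← sum_pderiv_generic_matrix, map_sum]
  simp only [herm_integration_by_parts]
  rw [← map_sum, map_mul (MvPolynomial.aeval _), MvPolynomial.aeval_X, pow_succ, Matrix.trace]
  simp only [Matrix.diag_apply, Matrix.mul_apply, sum_mul, Fintype.sum_prod_type]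
  refine congrArg _ (sum_congr rfl fun i _ => sum_congr rfl fun j _ => ?_)
  rw [Matrix.mvPolynomialX_apply, Prod.swap_prod_mk]
  ring

/-- Both functionals satisfy the same loop equations, hence are proportional. -/
theorem eigenFunctional_one_mul_hermFunctional {n : ℕ} (P : MvPolynomial ℕ ℂ) :
    eigenFunctional n 1 * hermFunctional n P = hermFunctional n 1 * eigenFunctional n P := by
  have h := eq_zero_of_loopEquations
    (eigenFunctional n 1 • hermFunctional n - hermFunctional n 1 • eigenFunctional n) n
    (fun P => by
      have h1 : hermFunctional n (MvPolynomial.X 0 * P) = n * hermFunctional n P := by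
        simp only [hermFunctional, LinearMap.comp_apply, AlgHom.toLinearMap_apply, map_mul,
          MvPolynomial.aeval_X, pow_zero, Matrix.trace_one, Fintype.card_fin]
        rw [← nsmul_eq_mul, map_nsmul, nsmul_eq_mul]
      have h2 : eigenFunctional n (MvPolynomial.X 0 * P) = n * eigenFunctional n P := by
        simp only [eigenFunctional, LinearMap.comp_apply, AlgHom.toLinearMap_apply, map_mul,
          MvPolynomial.aeval_X, MvPolynomial.psum_zero, Fintype.card_fin, LinearMap.mulRight_apply,
          mul_assoc]
        rw [← nsmul_eq_mul, map_nsmul, nsmul_eq_mul]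
      simp only [LinearMap.sub_apply, LinearMap.smul_apply, h1, h2, smul_eq_mul]
      ring)
    (fun m P => by
      simp only [LinearMap.sub_apply, LinearMap.smul_apply, hermFunctional_loop,
        eigenFunctional_loop])
    (by
      simp only [LinearMap.sub_apply, LinearMap.smul_apply, smul_eq_mul]
      ring)
  have h' := LinearMap.congr_fun h P
  simpa [sub_eq_zero] using h'

instance (n : ℕ) : CompactSpace (Matrix.unitaryGroup (Fin n) ℂ) := by
  have hcpt : IsCompact (Set.univ.pi fun _ : Fin n => Set.univ.pi fun _ : Fin n =>
      Metric.closedBall (0 : ℂ) 1) :=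
    isCompact_univ_pi fun _ => isCompact_univ_pi fun _ => isCompact_closedBall _ _
  refine isCompact_iff_compactSpace.1 (hcpt.of_isClosed_subset
    (isClosed_unitary (R := Matrix (Fin n) (Fin n) ℂ)) fun M hM => ?_)
  simp only [Set.mem_pi, Set.mem_univ, true_implies, mem_closedBall_zero_iff]
  exact fun i j => entry_norm_bound_of_unitary hM i j

noncomputable instance (n : ℕ) : MeasurableSpace (Matrix.unitaryGroup (Fin n) ℂ) := borel _

instance (n : ℕ) : BorelSpace (Matrix.unitaryGroup (Fin n) ℂ) := ⟨rfl⟩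

instance (n : ℕ) : SecondCountableTopology (Matrix.unitaryGroup (Fin n) ℂ) :=
  haveI : SecondCountableTopology (Matrix (Fin n) (Fin n) ℂ) :=
    inferInstanceAs (SecondCountableTopology (Fin n → Fin n → ℂ))
  inferInstanceAs (SecondCountableTopology
    (unitary (Matrix (Fin n) (Fin n) ℂ) : Set (Matrix (Fin n) (Fin n) ℂ)))

/-- The normalized Haar measure on the unitary group. -/
noncomputable def unitaryHaar (n : ℕ) : Measure (Matrix.unitaryGroup (Fin n) ℂ) :=
  Measure.haarMeasure ⊤

instance (n : ℕ) : IsProbabilityMeasure (unitaryHaar n) :=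
  ⟨Measure.haarMeasure_self⟩

instance (n : ℕ) : (unitaryHaar n).IsMulLeftInvariant := by
  unfold unitaryHaar
  infer_instance

/-- The conjugation action `H ↦ U* H U` in real coordinates. -/
noncomputable def hermConj {n : ℕ} (U : Matrix.unitaryGroup (Fin n) ℂ) :
    HermCoord n →ₗ[ℝ] HermCoord n where
  toFun x := hermCoords (star (U : Matrix (Fin n) (Fin n) ℂ) * herm n x * U)
  map_add' x y := by
    rw [map_add, mul_add, add_mul]
    refine Prod.ext ?_ (Prod.ext ?_ ?_) <;> ext p <;> simp [hermCoords]
  map_smul' c x := by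
    rw [map_smul, mul_smul_comm, smul_mul_assoc]
    refine Prod.ext ?_ (Prod.ext ?_ ?_) <;> ext p <;> simp [hermCoords]

theorem herm_hermConj {n : ℕ} (U : Matrix.unitaryGroup (Fin n) ℂ) (x : HermCoord n) :
    herm n (hermConj U x) = star (U : Matrix (Fin n) (Fin n) ℂ) * herm n x * U :=
  herm_hermCoords (Matrix.isHermitian_conjTranspose_mul_mul _ (herm_isHermitian x))

theorem herm_injective (n : ℕ) : Function.Injective (herm n) :=
  Function.LeftInverse.injective hermCoords_herm

theorem hermConj_mul {n : ℕ} (U W : Matrix.unitaryGroup (Fin n) ℂ) (x : HermCoord n) :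
    hermConj (U * W) x = hermConj W (hermConj U x) := by
  apply herm_injective
  simp only [herm_hermConj, Submonoid.coe_mul, star_mul, mul_assoc]

theorem hermConj_one {n : ℕ} (x : HermCoord n) : hermConj 1 x = x := by
  apply herm_injective
  simp [herm_hermConj]

theorem continuous_hermConj (n : ℕ) :
    Continuous fun p : Matrix.unitaryGroup (Fin n) ℂ × HermCoord n => hermConj p.1 p.2 := by
  refine continuous_hermCoords.comp ?_
  have h1 : Continuous fun p : Matrix.unitaryGroup (Fin n) ℂ × HermCoord n =>
      (p.1 : Matrix (Fin n) (Fin n) ℂ) := continuous_subtype_val.comp continuous_fst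
  exact (h1.star.mul ((continuous_herm n).comp continuous_snd)).mul h1

theorem traceForm_hermConj {n : ℕ} (U : Matrix.unitaryGroup (Fin n) ℂ) (x : HermCoord n) :
    traceForm n (hermConj U x) (hermConj U x) = traceForm n x x := by
  have h : (U : Matrix (Fin n) (Fin n) ℂ) * star (U : Matrix (Fin n) (Fin n) ℂ) = 1 :=
    Matrix.mem_unitaryGroup_iff.1 U.2
  rw [← Complex.ofReal_inj, ← trace_herm_mul_herm, ← trace_herm_mul_herm, herm_hermConj,
    mul_assoc, Matrix.trace_mul_comm]
  have : (U : Matrix (Fin n) (Fin n) ℂ) * (star (U : Matrix (Fin n) (Fin n) ℂ) * herm n x * U) *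
      (star (U : Matrix (Fin n) (Fin n) ℂ) * herm n x) =
      (U * star (U : Matrix (Fin n) (Fin n) ℂ)) * herm n x *
        ((U * star (U : Matrix (Fin n) (Fin n) ℂ)) * herm n x) := by
    simp only [mul_assoc]
  rw [this, h, one_mul]

theorem hermWeight_hermConj {n : ℕ} (U : Matrix.unitaryGroup (Fin n) ℂ) (x : HermCoord n) :
    hermWeight (hermConj U x) = hermWeight x := by
  rw [hermWeight, traceForm_hermConj, hermWeight]

theorem exists_norm_hermConj_le (n : ℕ) : ∃ K : ℝ, 0 ≤ K ∧
    ∀ (U : Matrix.unitaryGroup (Fin n) ℂ) (x : HermCoord n), ‖hermConj U x‖ ≤ K * ‖x‖ := by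
  obtain ⟨K, hK, h⟩ := exists_traceForm_le n
  refine ⟨K, hK, fun U x => ?_⟩
  have := (norm_sq_le_traceForm (hermConj U x)).trans_eq (traceForm_hermConj U x)
  have := this.trans (h x)
  rw [← mul_pow] at this
  exact le_of_sq_le_sq this (by positivity)

theorem hermWeight_pos {n : ℕ} (x : HermCoord n) : 0 < hermWeight x := Real.exp_pos _

theorem integrable_hermWeight (n : ℕ) : Integrable (hermWeight (n := n)) := by
  have h := (ExpBounded.const (V := HermCoord n) 1).integrable_mul (μ := volume)
    (isGaussianWeight_hermWeight n)
  simp only [one_mul] at h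
  exact h.re

theorem integral_hermWeight_pos (n : ℕ) : 0 < ∫ x : HermCoord n, hermWeight x := by
  rw [integral_pos_iff_support_of_nonneg (fun x => (hermWeight_pos x).le)
    (integrable_hermWeight n)]
  have : Function.support (hermWeight (n := n)) = Set.univ :=
    Set.eq_univ_of_forall fun x => (hermWeight_pos x).ne'
  rw [this]
  exact isOpen_univ.measure_pos volume Set.univ_nonempty

/-- Conjugation by a unitary matrix preserves Lebesgue measure on Hermitian matrices. -/
theorem measurePreserving_hermConj {n : ℕ} (U : Matrix.unitaryGroup (Fin n) ℂ) :
    MeasurePreserving (hermConj U) (volume : Measure (HermCoord n)) volume := by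
  have hc : Continuous (hermConj U) :=
    LinearMap.continuous_of_finiteDimensional _
  have hdet : LinearMap.det (hermConj U) ≠ 0 := by
    have : (hermConj U⁻¹) ∘ₗ (hermConj U) = LinearMap.id := by
      refine LinearMap.ext fun x => ?_
      rw [LinearMap.comp_apply, ← hermConj_mul, mul_inv_cancel, hermConj_one, LinearMap.id_apply]
    have := congrArg LinearMap.det this
    rw [LinearMap.det_comp, LinearMap.det_id] at this
    exact right_ne_zero_of_mul_eq_one this
  refine ⟨hc.measurable, ?_⟩
  have hmap := Measure.map_linearMap_addHaar_eq_smul_addHaar (volume : Measure (HermCoord n)) hdet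
  have h : ∫ x, hermWeight x ∂(Measure.map (hermConj U) volume)
      = ∫ x : HermCoord n, hermWeight x := by
    rw [integral_map hc.aemeasurable
      (isGaussianWeight_hermWeight n).1.aestronglyMeasurable]
    simp only [hermWeight_hermConj]
  rw [hmap, integral_smul_measure, smul_eq_mul,
    mul_eq_right₀ (integral_hermWeight_pos n).ne'] at h
  rw [hmap, (ENNReal.toReal_eq_one_iff _).1 h, one_smul]

/-- The diagonal matrices, in the real coordinates. -/
noncomputable def hermDiag (n : ℕ) : (Fin n → ℝ) →ₗ[ℝ] HermCoord n := LinearMap.inl ℝ _ _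

theorem herm_hermDiag {n : ℕ} (E : Fin n → ℝ) :
    herm n (hermDiag n E) = Matrix.diagonal fun i => (E i : ℂ) := by
  ext i j
  by_cases h : i = j
  · subst h
    simp [herm_diag, hermDiag]
  · rw [Matrix.diagonal_apply_ne _ h, herm_apply]
    rcases lt_or_gt_of_ne h with h | h
    · simp [hermOf, hermDiag, h]
    · simp [hermOf, hermDiag, h, h.not_gt]

theorem exists_hermConj_hermDiag_eq {n : ℕ} (x : HermCoord n) :
    ∃ (W : Matrix.unitaryGroup (Fin n) ℂ) (E : Fin n → ℝ), hermConj W (hermDiag n E) = x := by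
  have hx := herm_isHermitian x
  refine ⟨star hx.eigenvectorUnitary, hx.eigenvalues, herm_injective n ?_⟩
  rw [herm_hermConj, herm_hermDiag]
  conv_rhs => rw [hx.spectral_theorem, Unitary.conjStarAlgAut_apply]
  simp
  rfl

theorem exists_hermConj_perm {n : ℕ} (σ : Equiv.Perm (Fin n)) :
    ∃ W : Matrix.unitaryGroup (Fin n) ℂ, ∀ E : Fin n → ℝ,
      hermConj W (hermDiag n (E ∘ σ)) = hermDiag n E := by
  have hP : (1 : Matrix (Fin n) (Fin n) ℂ).submatrix σ id ∈ Matrix.unitaryGroup (Fin n) ℂ := by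
    rw [Matrix.mem_unitaryGroup_iff, Matrix.star_eq_conjTranspose, Matrix.conjTranspose_submatrix,
      Matrix.conjTranspose_one, ← Matrix.submatrix_mul _ _ _ id _ Function.bijective_id, mul_one,
      Matrix.submatrix_one_equiv]
  refine ⟨⟨_, hP⟩, fun E => herm_injective n ?_⟩
  have hD : (Matrix.diagonal fun i => ((E ∘ σ) i : ℂ))
      = (Matrix.diagonal fun i => (E i : ℂ)).submatrix σ σ :=
    (Matrix.submatrix_diagonal_equiv (fun i => (E i : ℂ)) σ).symm
  rw [herm_hermConj, herm_hermDiag, herm_hermDiag, Matrix.star_eq_conjTranspose,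
    Matrix.conjTranspose_submatrix, Matrix.conjTranspose_one, hD, Matrix.submatrix_mul_equiv,
    Matrix.submatrix_mul_equiv, one_mul, mul_one, Matrix.submatrix_id_id]

/-- Moments of a linear form over a unitary orbit. -/
noncomputable def orbitMoment {n : ℕ} (L : StrongDual ℝ (HermCoord n)) (k : ℕ) (x : HermCoord n) :
    ℂ := ∫ U, ((L (hermConj U x) : ℝ) : ℂ) ^ k ∂unitaryHaar n

theorem orbitMoment_hermConj {n : ℕ} (L : StrongDual ℝ (HermCoord n)) (k : ℕ)
    (W : Matrix.unitaryGroup (Fin n) ℂ) (x : HermCoord n) :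
    orbitMoment L k (hermConj W x) = orbitMoment L k x := by
  simp only [orbitMoment, ← hermConj_mul]
  exact integral_mul_left_eq_self (fun U => ((L (hermConj U x) : ℝ) : ℂ) ^ k) W

theorem continuous_hermConj_left {n : ℕ} (x : HermCoord n) :
    Continuous fun U : Matrix.unitaryGroup (Fin n) ℂ => hermConj U x := by
  have h := (continuous_hermConj n).comp (Continuous.prodMk_left x)
  exact h

theorem exists_orbitMoment_hermDiag_eq {n : ℕ} (L : StrongDual ℝ (HermCoord n)) (k : ℕ) :
    ∃ s : MvPolynomial (Fin n) ℂ, ∀ E : Fin n → ℝ,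
      orbitMoment L k (hermDiag n E) = MvPolynomial.eval (fun i => (E i : ℂ)) s := by
  set c : Fin n → Matrix.unitaryGroup (Fin n) ℂ → ℂ := fun i U =>
    (L (hermConj U (hermDiag n (Pi.single i 1))) : ℝ) with hc
  have hcc : ∀ i, Continuous (c i) := fun i =>
    Complex.continuous_ofReal.comp (L.continuous.comp (continuous_hermConj_left _))
  refine ⟨∑ p : Fin k → Fin n, MvPolynomial.C (∫ U, ∏ j, c (p j) U ∂unitaryHaar n) *
    ∏ j, MvPolynomial.X (p j), fun E => ?_⟩
  have hL : ∀ U, ((L (hermConj U (hermDiag n E)) : ℝ) : ℂ) = ∑ i, c i U * E i := by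
    intro U
    conv_lhs => rw [pi_eq_sum_univ' E]
    simp [hc, mul_comm]
  simp only [orbitMoment, hL, Fintype.sum_pow, prod_mul_distrib, map_sum, map_mul,
    MvPolynomial.eval_C, map_prod, MvPolynomial.eval_X]
  rw [integral_finsetSum]
  · simp only [integral_mul_const]
  · intro p _
    exact ((continuous_finsetProd _ fun j _ => hcc (p j)).integrable_of_hasCompactSupport
      (HasCompactSupport.of_compactSpace _)).mul_const _

theorem eval_aeval {σ τ : Type*} (z : τ → ℂ) (g : σ → MvPolynomial τ ℂ) (P : MvPolynomial σ ℂ) :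
    MvPolynomial.eval z (MvPolynomial.aeval g P)
      = MvPolynomial.eval (fun k => MvPolynomial.eval z (g k)) P := by
  induction P using MvPolynomial.induction_on with
  | C a => simp
  | add p q hp hq => simp only [map_add, hp, hq]
  | mul_X p i hp => simp only [map_mul, hp, MvPolynomial.aeval_X, MvPolynomial.eval_X]

/-- Orbit moments are polynomials in the traces of powers. -/
theorem exists_orbitMoment_eq {n : ℕ} (L : StrongDual ℝ (HermCoord n)) (k : ℕ) :
    ∃ P : MvPolynomial ℕ ℂ,
      (∀ E : Fin n → ℝ, orbitMoment L k (hermDiag n E) =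
        MvPolynomial.eval (fun i => eigenCoord i E)
          (MvPolynomial.aeval (MvPolynomial.psum (Fin n) ℂ) P)) ∧
      ∀ x : HermCoord n, orbitMoment L k x =
        MvPolynomial.eval (fun s => hermEntry s x) (MvPolynomial.aeval
          (fun k => (Matrix.mvPolynomialX (Fin n) (Fin n) ℂ ^ k).trace) P) := by
  obtain ⟨s, hs⟩ := exists_orbitMoment_hermDiag_eq L k
  have hsymm : s.IsSymmetric := by
    intro σ
    refine MvPolynomial.funext_set (fun _ => Set.range Complex.ofReal)
      (fun _ => Set.infinite_range_of_injective Complex.ofReal_injective) fun z hz => ?_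
    choose E hE using fun i => hz i trivial
    obtain rfl : (fun i => (E i : ℂ)) = z := funext hE
    rw [MvPolynomial.eval_rename]
    obtain ⟨W, hW⟩ := exists_hermConj_perm σ
    rw [← hs, ← hW E, orbitMoment_hermConj, hs]
    rfl
  obtain ⟨P, hP⟩ := exists_aeval_psum_eq s hsymm
  have hdiag : ∀ E : Fin n → ℝ, orbitMoment L k (hermDiag n E) =
      MvPolynomial.eval (fun i => eigenCoord i E)
        (MvPolynomial.aeval (MvPolynomial.psum (Fin n) ℂ) P) := by
    intro E
    rw [hP, hs]
    rfl
  refine ⟨P, hdiag, fun x => ?_⟩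
  have hpow : ∀ (x : HermCoord n) (k : ℕ), MvPolynomial.eval (fun s => hermEntry s x)
      (Matrix.mvPolynomialX (Fin n) (Fin n) ℂ ^ k).trace = (herm n x ^ k).trace := by
    intro x k
    have h : (MvPolynomial.eval fun s => hermEntry s x).mapMatrix
        (Matrix.mvPolynomialX (Fin n) (Fin n) ℂ) = herm n x :=
      Matrix.mvPolynomialX_mapMatrix_eval (herm n x)
    rw [← h, ← map_pow]
    exact AddMonoidHom.map_trace _ _
  obtain ⟨W, E, rfl⟩ := exists_hermConj_hermDiag_eq x
  have htr : ∀ k, (herm n (hermConj W (hermDiag n E)) ^ k).trace = ∑ i, (E i : ℂ) ^ k := by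
    intro k
    have h : (W : Matrix (Fin n) (Fin n) ℂ) * star (W : Matrix (Fin n) (Fin n) ℂ) = 1 :=
      Matrix.mem_unitaryGroup_iff.1 W.2
    have hp : (star (W : Matrix (Fin n) (Fin n) ℂ) * herm n (hermDiag n E) * W) ^ k
        = star (W : Matrix (Fin n) (Fin n) ℂ) * herm n (hermDiag n E) ^ k * W := by
      induction k with
      | zero => simp
      | succ k ih =>
        rw [pow_succ, ih, pow_succ]
        simp only [← mul_assoc]
        rw [mul_assoc (_ * _) (W : Matrix (Fin n) (Fin n) ℂ), h, mul_one]
    rw [herm_hermConj, hp, Matrix.trace_mul_cycle, h, one_mul, herm_hermDiag, Matrix.diagonal_pow,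
      Matrix.trace_diagonal]
    rfl
  rw [orbitMoment_hermConj, hdiag]
  rw [eval_aeval, eval_aeval]
  simp only [hpow, htr]
  simp [MvPolynomial.psum]

/-- The average of `exp (i L)` over a unitary orbit. -/
noncomputable def orbitExp {n : ℕ} (L : StrongDual ℝ (HermCoord n)) (x : HermCoord n) : ℂ :=
  ∫ U, Complex.exp ((L (hermConj U x) : ℝ) * Complex.I) ∂unitaryHaar n

theorem exists_orbit_bound {n : ℕ} (L : StrongDual ℝ (HermCoord n)) : ∃ R : ℝ, 0 ≤ R ∧
    ∀ (U : Matrix.unitaryGroup (Fin n) ℂ) (x : HermCoord n), ‖L (hermConj U x)‖ ≤ R * ‖x‖ := by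
  obtain ⟨K, hK, h⟩ := exists_norm_hermConj_le n
  refine ⟨‖L‖ * K, by positivity, fun U x => (L.le_opNorm _).trans ?_⟩
  rw [mul_assoc]
  gcongr
  exact h U x

theorem norm_orbitMoment_le {n : ℕ} {L : StrongDual ℝ (HermCoord n)} {R : ℝ}
    (hR : ∀ (U : Matrix.unitaryGroup (Fin n) ℂ) (x : HermCoord n), ‖L (hermConj U x)‖ ≤ R * ‖x‖)
    (k : ℕ) (x : HermCoord n) : ‖orbitMoment L k x‖ ≤ (R * ‖x‖) ^ k := by
  refine (norm_integral_le_of_norm_le_const (C := (R * ‖x‖) ^ k) (.of_forall fun U => ?_)).trans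
    (by simp)
  rw [norm_pow, Complex.norm_real]
  gcongr
  exact hR U x

theorem hasSum_orbitExp {n : ℕ} (L : StrongDual ℝ (HermCoord n)) (x : HermCoord n) :
    HasSum (fun k : ℕ => (Complex.I ^ k / k.factorial) * orbitMoment L k x) (orbitExp L x) := by
  obtain ⟨R, _, hR⟩ := exists_orbit_bound L
  simp only [orbitMoment, ← integral_const_mul]
  refine hasSum_integral_of_dominated_convergence (fun k _ => (R * ‖x‖) ^ k / k.factorial)
    (fun k => ?_) (fun k => .of_forall fun U => ?_) (.of_forall fun U => ?_)
    (integrable_const _) (.of_forall fun U => ?_)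
  · exact (continuous_const.mul ((Complex.continuous_ofReal.comp
      (L.continuous.comp (continuous_hermConj_left x))).pow k)).aestronglyMeasurable
  · rw [norm_mul, norm_div, norm_pow, Complex.norm_I, one_pow, norm_pow, Complex.norm_real,
      Complex.norm_natCast, one_div_mul_eq_div]
    gcongr
    exact hR U x
  · exact Real.summable_pow_div_factorial _
  · have h := NormedSpace.expSeries_div_hasSum_exp (𝔸 := ℂ)
      ((L (hermConj U x) : ℝ) * Complex.I)
    rw [← Complex.exp_eq_exp_ℂ] at h
    have hk : ∀ (k : ℕ) (a : ℂ), (a * Complex.I) ^ k / k.factorial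
        = Complex.I ^ k / k.factorial * a ^ k := fun k a => by ring
    simpa only [hk] using h

section DominatedExpansion

variable {V : Type*} [NormedAddCommGroup V] [NormedSpace ℝ V] [FiniteDimensional ℝ V]
  [MeasurableSpace V] [BorelSpace V] {μ : Measure V} [μ.IsAddHaarMeasure]

/-- Termwise integration of exponential series against a Gaussian weight. -/
theorem hasSum_integral_gaussian {w : V → ℝ} (hw : IsGaussianWeight w) {p : V → ℂ}
    (hp : ExpBounded p) {g : ℕ → V → ℂ} (hg : ∀ k, Continuous (g k)) {R : ℝ}
    (hb : ∀ k x, ‖g k x‖ ≤ (R * ‖x‖) ^ k) {F : V → ℂ}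
    (hF : ∀ x, HasSum (fun k : ℕ => (Complex.I ^ k / k.factorial) * g k x) (F x)) :
    HasSum (fun k : ℕ => (Complex.I ^ k / k.factorial) * ∫ x, g k x * p x * w x ∂μ)
      (∫ x, F x * p x * w x ∂μ) := by
  simp only [← integral_const_mul]
  have hsum : ∀ x, HasSum (fun k : ℕ => (R * ‖x‖) ^ k / k.factorial * (‖p x‖ * ‖(w x : ℂ)‖))
      (Real.exp (R * ‖x‖) * (‖p x‖ * ‖(w x : ℂ)‖)) := by
    intro x
    have h := NormedSpace.expSeries_div_hasSum_exp (𝔸 := ℝ) (R * ‖x‖)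
    rw [← Real.exp_eq_exp_ℝ] at h
    exact h.mul_right _
  refine hasSum_integral_of_dominated_convergence
    (fun k x => (R * ‖x‖) ^ k / k.factorial * (‖p x‖ * ‖(w x : ℂ)‖))
    (fun k => ?_) (fun k => .of_forall fun x => ?_) (.of_forall fun x => (hsum x).summable)
    ?_ (.of_forall fun x => ?_)
  · exact (continuous_const.mul (((hg k).mul hp.1).mul
      (Complex.continuous_ofReal.comp hw.1))).aestronglyMeasurable
  · rw [norm_mul, norm_div, norm_pow, Complex.norm_I, one_pow, Complex.norm_natCast, norm_mul,
      norm_mul, mul_assoc, ← mul_assoc, one_div_mul_eq_div]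
    gcongr
    exact hb k x
  · simp only [fun x => (hsum x).tsum_eq]
    have hexp : ExpBounded (fun x : V => ((Real.exp (R * ‖x‖) : ℝ) : ℂ)) := by
      refine ⟨by fun_prop, 1, R, fun x => ?_⟩
      rw [Complex.norm_real, Real.norm_eq_abs, Real.abs_exp, one_mul]
    refine ((hexp.mul hp).integrable_mul hw (μ := μ)).norm.congr (.of_forall fun x => ?_)
    simp only [norm_mul, Complex.norm_real, Real.norm_eq_abs, Real.abs_exp, mul_assoc]
  · simpa only [mul_assoc] using (hF x).mul_right (p x * w x)

end DominatedExpansion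

theorem integral_orbitExp_eq {n : ℕ} (L : StrongDual ℝ (HermCoord n)) :
    eigenFunctional n 1 * ∫ x, orbitExp L x * (hermWeight x : ℂ) =
      hermFunctional n 1 * ∫ E, orbitExp L (hermDiag n E) *
        MvPolynomial.eval (fun i => eigenCoord i E) (vandermondePoly n ^ 2) *
          (eigenWeight E : ℂ) := by
  obtain ⟨R, _, hR⟩ := exists_orbit_bound L
  choose P hP1 hP2 using exists_orbitMoment_eq L
  have h1 := hasSum_integral_gaussian (μ := volume) (isGaussianWeight_hermWeight n)
    (ExpBounded.const 1) (g := orbitMoment L)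
    (fun k => by rw [funext (hP2 k)]; exact (ExpBounded.eval _ _).1)
    (norm_orbitMoment_le hR) (hasSum_orbitExp L)
  have hnorm : ∀ E : Fin n → ℝ, ‖hermDiag n E‖ = ‖E‖ := fun E => by
    simp [hermDiag, Prod.norm_def]
  have h2 := hasSum_integral_gaussian (μ := volume) (isGaussianWeight_eigenWeight n)
    (ExpBounded.eval eigenCoord (vandermondePoly n ^ 2))
    (g := fun k E => orbitMoment L k (hermDiag n E))
    (fun k => by rw [funext (hP1 k)]; exact (ExpBounded.eval _ _).1)
    (fun k E => by simpa only [hnorm] using norm_orbitMoment_le hR k (hermDiag n E))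
    (fun E => hasSum_orbitExp L (hermDiag n E))
  have e1 : ∀ k, ∫ x, orbitMoment L k x * 1 * (hermWeight x : ℂ) = hermFunctional n (P k) := by
    intro k
    simp only [mul_one, hP2]
    rfl
  have e2 : ∀ k, ∫ E, orbitMoment L k (hermDiag n E) *
      MvPolynomial.eval (fun i => eigenCoord i E) (vandermondePoly n ^ 2) * (eigenWeight E : ℂ)
      = eigenFunctional n (P k) := by
    intro k
    simp only [hP1, ← map_mul]
    rfl
  simp only [e1] at h1
  simp only [e2] at h2
  simp only [mul_one] at h1
  refine (h1.mul_left (eigenFunctional n 1)).unique ?_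
  convert h2.mul_left (hermFunctional n 1) using 2 with k
  linear_combination (Complex.I ^ k / k.factorial) * eigenFunctional_one_mul_hermFunctional (P k)

/-- The Gaussian integral of `exp (i L)` may be averaged over unitary orbits. -/
theorem integral_orbitExp_mul_hermWeight {n : ℕ} (L : StrongDual ℝ (HermCoord n)) :
    ∫ x, orbitExp L x * (hermWeight x : ℂ)
      = ∫ x, Complex.exp ((L x : ℝ) * Complex.I) * (hermWeight x : ℂ) := by
  have hmap : ∀ U : Matrix.unitaryGroup (Fin n) ℂ,
      ∫ x, Complex.exp ((L (hermConj U x) : ℝ) * Complex.I) * (hermWeight x : ℂ)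
        = ∫ x, Complex.exp ((L x : ℝ) * Complex.I) * (hermWeight x : ℂ) := by
    intro U
    have hm := measurePreserving_hermConj U
    conv_rhs => rw [← hm.map_eq]
    rw [integral_map hm.measurable.aemeasurable]
    · simp only [hermWeight_hermConj]
    · have := (isGaussianWeight_hermWeight n).1
      exact Continuous.aestronglyMeasurable (by fun_prop)
  simp only [orbitExp, ← integral_mul_const]
  rw [integral_integral_swap]
  · simp only [hmap, integral_const, probReal_univ, one_smul]
  · have hw' : Integrable (fun x : HermCoord n => (hermWeight x : ℂ)) :=
      (integrable_hermWeight n).ofReal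
    have hw : Integrable (fun p : HermCoord n × Matrix.unitaryGroup (Fin n) ℂ =>
        (hermWeight p.1 : ℂ)) (volume.prod (unitaryHaar n)) :=
      hw'.comp_fst _
    refine hw.bdd_mul (c := 1) ?_ (.of_forall fun p => ?_)
    · have hc := (continuous_hermConj n).comp (continuous_swap (X := HermCoord n))
      have hL : Continuous fun p : HermCoord n × Matrix.unitaryGroup (Fin n) ℂ =>
        L (hermConj p.2 p.1) := L.continuous.comp hc
      exact Continuous.aestronglyMeasurable (by fun_prop)
    · exact (Complex.norm_exp_ofReal_mul_I _).le

section Density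

variable {V : Type*} [MeasurableSpace V] {μ : Measure V}

theorem integral_withDensity_toNNReal {w : V → ℝ} (hw : Measurable w) (h0 : ∀ x, 0 ≤ w x)
    (g : V → ℂ) : ∫ x, g x ∂μ.withDensity (fun x => ((w x).toNNReal : ENNReal))
      = ∫ x, g x * (w x : ℂ) ∂μ := by
  rw [integral_withDensity_eq_integral_smul hw.real_toNNReal]
  refine integral_congr_ae (.of_forall fun x => ?_)
  simp [NNReal.smul_def, Real.coe_toNNReal _ (h0 x), mul_comm]

theorem isFiniteMeasure_withDensity_toNNReal {w : V → ℝ} (hw : Integrable w μ) :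
    IsFiniteMeasure (μ.withDensity fun x => ((w x).toNNReal : ENNReal)) :=
  isFiniteMeasure_withDensity_ofReal hw.2

end Density

/-- The squared Vandermonde determinant. -/
noncomputable def vandermondeSq {n : ℕ} (E : Fin n → ℝ) : ℝ :=
  (∏ a : Fin n, ∏ b ∈ Ioi a, (E a - E b)) ^ 2

theorem eval_vandermondePoly_sq {n : ℕ} (E : Fin n → ℝ) :
    MvPolynomial.eval (fun i => eigenCoord i E) (vandermondePoly n ^ 2)
      = (vandermondeSq E : ℂ) := by
  simp [vandermondePoly, vandermondeSq]

theorem continuous_vandermondeSq (n : ℕ) : Continuous (vandermondeSq (n := n)) := by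
  unfold vandermondeSq
  fun_prop

theorem eigenWeight_pos {n : ℕ} (E : Fin n → ℝ) : 0 < eigenWeight E := Real.exp_pos _

theorem integrable_vandermondeSq_mul (n : ℕ) :
    Integrable fun E : Fin n → ℝ => vandermondeSq E * eigenWeight E := by
  have h := (ExpBounded.eval eigenCoord (vandermondePoly n ^ 2)).integrable_mul (μ := volume)
    (isGaussianWeight_eigenWeight n)
  simp only [eval_vandermondePoly_sq, ← Complex.ofReal_mul] at h
  exact h.re

/-- The Gaussian measure on Hermitian matrices (not normalized). -/
noncomputable def hermGaussian (n : ℕ) : Measure (HermCoord n) :=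
  volume.withDensity fun x => ((hermWeight x).toNNReal : ENNReal)

/-- The eigenvalue measure of the Gaussian unitary ensemble (not normalized). -/
noncomputable def eigenGaussian (n : ℕ) : Measure (Fin n → ℝ) :=
  volume.withDensity fun E => ((vandermondeSq E * eigenWeight E).toNNReal : ENNReal)

instance (n : ℕ) : IsFiniteMeasure (hermGaussian n) :=
  isFiniteMeasure_withDensity_toNNReal (integrable_hermWeight n)

instance (n : ℕ) : IsFiniteMeasure (eigenGaussian n) :=
  isFiniteMeasure_withDensity_toNNReal (integrable_vandermondeSq_mul n)

theorem integral_hermGaussian {n : ℕ} (g : HermCoord n → ℂ) :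
    ∫ x, g x ∂hermGaussian n = ∫ x, g x * (hermWeight x : ℂ) :=
  integral_withDensity_toNNReal (isGaussianWeight_hermWeight n).1.measurable
    (fun x => (hermWeight_pos x).le) g

theorem integral_eigenGaussian {n : ℕ} (g : (Fin n → ℝ) → ℂ) :
    ∫ E, g E ∂eigenGaussian n = ∫ E, g E * ((vandermondeSq E * eigenWeight E : ℝ) : ℂ) :=
  integral_withDensity_toNNReal
    ((continuous_vandermondeSq n).mul (isGaussianWeight_eigenWeight n).1).measurable
    (fun E => mul_nonneg (sq_nonneg _) (eigenWeight_pos E).le) g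

/-- Conjugating a diagonal matrix by a unitary matrix. -/
noncomputable def conjDiag (n : ℕ) (p : Matrix.unitaryGroup (Fin n) ℂ × (Fin n → ℝ)) :
    HermCoord n := hermConj p.1 (hermDiag n p.2)

theorem continuous_conjDiag (n : ℕ) : Continuous (conjDiag n) := by
  have hd : Continuous (hermDiag n) := LinearMap.continuous_of_finiteDimensional _
  have h := (continuous_hermConj n).comp
    (Continuous.prodMap (continuous_id (X := Matrix.unitaryGroup (Fin n) ℂ)) hd)
  exact h

/-- The total mass of the Gaussian measure on Hermitian matrices. -/
noncomputable def hermMass (n : ℕ) : NNReal :=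
  ⟨∫ x : HermCoord n, hermWeight x, integral_nonneg fun x => (hermWeight_pos x).le⟩

/-- The total mass of the Gaussian eigenvalue measure. -/
noncomputable def eigenMass (n : ℕ) : NNReal :=
  ⟨∫ E : Fin n → ℝ, vandermondeSq E * eigenWeight E,
    integral_nonneg fun E => mul_nonneg (sq_nonneg _) (eigenWeight_pos E).le⟩

theorem hermFunctional_one (n : ℕ) : hermFunctional n 1 = ((hermMass n : ℝ) : ℂ) := by
  have h : hermFunctional n 1 = ∫ x : HermCoord n, (hermWeight x : ℂ) := by
    simp [hermFunctional, gaussianFunctional]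
  rw [h]
  exact integral_ofReal

theorem eigenFunctional_one (n : ℕ) : eigenFunctional n 1 = ((eigenMass n : ℝ) : ℂ) := by
  have h : eigenFunctional n 1
      = ∫ E : Fin n → ℝ, ((vandermondeSq E * eigenWeight E : ℝ) : ℂ) := by
    simp only [eigenFunctional, gaussianFunctional, LinearMap.comp_apply, AlgHom.toLinearMap_apply,
      map_one, LinearMap.mulRight_apply, one_mul, LinearMap.coe_mk, AddHom.coe_mk,
      eval_vandermondePoly_sq, Complex.ofReal_mul]
  rw [h]
  exact integral_ofReal

/-- Up to normalization, the Gaussian measure on Hermitian matrices is the law of a diagonal matrix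
with entries distributed according to `eigenGaussian`, conjugated by an independent Haar-distributed
unitary matrix. -/
theorem smul_hermGaussian_eq (n : ℕ) : eigenMass n • hermGaussian n =
    hermMass n • ((unitaryHaar n).prod (eigenGaussian n)).map (conjDiag n) := by
  have hΨ := continuous_conjDiag n
  refine Measure.ext_of_charFunDual (funext fun L => ?_)
  simp only [charFunDual_apply]
  rw [integral_smul_nnreal_measure, integral_smul_nnreal_measure, integral_hermGaussian,
    ← integral_orbitExp_mul_hermWeight, integral_map hΨ.aemeasurable
      (Continuous.aestronglyMeasurable (by fun_prop)), integral_prod_symm]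
  · have h := integral_orbitExp_eq L
    rw [hermFunctional_one, eigenFunctional_one] at h
    simp only [eval_vandermondePoly_sq, mul_assoc] at h
    rw [NNReal.smul_def, NNReal.smul_def, Complex.real_smul, Complex.real_smul, h]
    congr 1
    simp only [conjDiag]
    rw [integral_eigenGaussian]
    simp only [Complex.ofReal_mul]
    rfl
  · refine Integrable.of_bound (C := 1) (Continuous.aestronglyMeasurable (by fun_prop))
      (.of_forall fun p => ?_)
    exact (Complex.norm_exp_ofReal_mul_I _).le

theorem weyl_integration_of_mass {n : ℕ} (f : Matrix (Fin n) (Fin n) ℂ → ℂ)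
    (hinv : ∀ H : Matrix (Fin n) (Fin n) ℂ, H.IsHermitian →
      ∀ U ∈ Matrix.unitaryGroup (Fin n) ℂ, f (U * H * star U) = f H)
    (hf : AEStronglyMeasurable (fun x => f (herm n x))) :
    (eigenMass n : ℂ) * ∫ x, f (herm n x) = (hermMass n : ℂ) * ∫ E : Fin n → ℝ,
      (vandermondeSq E : ℂ) * f (Matrix.diagonal fun i => (E i : ℂ)) := by
  have hΨ := continuous_conjDiag n
  set φ : HermCoord n → ℂ := fun x => f (herm n x) * ((hermWeight x)⁻¹ : ℝ) with hφ
  have hconj : ∀ p, φ (conjDiag n p)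
      = f (Matrix.diagonal fun i => (p.2 i : ℂ)) * ((eigenWeight p.2)⁻¹ : ℝ) := by
    intro p
    have h1 : f (herm n (conjDiag n p)) = f (Matrix.diagonal fun i => (p.2 i : ℂ)) := by
      rw [conjDiag, herm_hermConj, ← herm_hermDiag]
      simpa using hinv _ (herm_isHermitian (hermDiag n p.2)) _ (star p.1).2
    have h2 : hermWeight (conjDiag n p) = eigenWeight p.2 := by
      rw [conjDiag, hermWeight_hermConj, hermWeight, traceForm_self, eigenWeight]
      simp [hermDiag]
    rw [hφ]
    simp only [h1, h2]
  have hmass : hermMass n ≠ 0 := fun h =>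
    (integral_hermWeight_pos n).ne' (congrArg NNReal.toReal h)
  have hφm : AEStronglyMeasurable φ
      (((unitaryHaar n).prod (eigenGaussian n)).map (conjDiag n)) := by
    have h0 : AEStronglyMeasurable φ volume := by
      refine hf.mul (Continuous.aestronglyMeasurable (Complex.continuous_ofReal.comp ?_))
      exact (isGaussianWeight_hermWeight n).1.inv₀ fun x => (hermWeight_pos x).ne'
    have h1 : AEStronglyMeasurable φ (eigenMass n • hermGaussian n) :=
      (h0.mono_ac (withDensity_absolutelyContinuous _ _)).smul_measure _
    rw [smul_hermGaussian_eq] at h1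
    exact h1.mono_ac (Measure.absolutelyContinuous_smul (ENNReal.coe_ne_zero.2 hmass))
  have h := congrArg (fun ν => ∫ x, φ x ∂ν) (smul_hermGaussian_eq n)
  rw [integral_smul_nnreal_measure, integral_smul_nnreal_measure, integral_hermGaussian,
    integral_map hΨ.aemeasurable hφm] at h
  simp only [hconj] at h
  rw [integral_fun_snd (fun E : Fin n → ℝ => f (Matrix.diagonal fun i => (E i : ℂ)) *
    ((eigenWeight E)⁻¹ : ℝ)), probReal_univ, one_smul, integral_eigenGaussian] at h
  have e1 : ∀ x, φ x * (hermWeight x : ℂ) = f (herm n x) := fun x => by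
    rw [hφ]
    simp only
    rw [mul_assoc, ← Complex.ofReal_mul, inv_mul_cancel₀ (hermWeight_pos x).ne',
      Complex.ofReal_one, mul_one]
  have e2 : ∀ E : Fin n → ℝ, f (Matrix.diagonal fun i => (E i : ℂ)) * ((eigenWeight E)⁻¹ : ℝ) *
      ((vandermondeSq E * eigenWeight E : ℝ) : ℂ)
      = (vandermondeSq E : ℂ) * f (Matrix.diagonal fun i => (E i : ℂ)) := fun E => by
    have : (eigenWeight E : ℂ) ≠ 0 := Complex.ofReal_ne_zero.2 (eigenWeight_pos E).ne'
    push_cast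
    field_simp
  simp only [e1, e2] at h
  rwa [NNReal.smul_def, NNReal.smul_def, Complex.real_smul, Complex.real_smul] at h

theorem integrable_polynomial_mul_gaussian (p : Polynomial ℝ) :
    Integrable fun x : ℝ => p.eval x * Real.exp (-x ^ 2 / 2) := by
  induction p using Polynomial.induction_on' with
  | add p q hp hq =>
    simp only [Polynomial.eval_add, add_mul]
    exact hp.add hq
  | monomial k a =>
    have h := integrable_rpow_mul_exp_neg_mul_sq (b := 1 / 2) (by norm_num) (s := k)
      (by linarith [(Nat.cast_nonneg k : (0 : ℝ) ≤ k)])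
    refine (h.const_mul a).congr (.of_forall fun x => ?_)
    simp only [Polynomial.eval_monomial, Real.rpow_natCast]
    rw [mul_assoc]
    congr 3
    ring

theorem integral_derivative_mul_gaussian (p : Polynomial ℝ) :
    ∫ x : ℝ, (Polynomial.derivative p - Polynomial.X * p).eval x * Real.exp (-x ^ 2 / 2) = 0 := by
  refine integral_eq_zero_of_hasDerivAt_of_integrable (fun x => ?_)
    (integrable_polynomial_mul_gaussian _) (integrable_polynomial_mul_gaussian p)
  have h1 : HasDerivAt (fun x : ℝ => Real.exp (-x ^ 2 / 2))
      (Real.exp (-x ^ 2 / 2) * (-(2 * x) / 2)) x := by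
    simpa using (((hasDerivAt_id x).pow 2).neg.div_const 2).exp
  refine (p.hasDerivAt x |>.mul h1).congr_deriv ?_
  simp only [Polynomial.eval_sub, Polynomial.eval_mul, Polynomial.eval_X]
  ring

/-- The probabilists' Hermite polynomials with real coefficients. -/
noncomputable def hermiteReal (k : ℕ) : Polynomial ℝ :=
  (Polynomial.hermite k).map (Int.castRingHom ℝ)

theorem hermiteReal_monic (k : ℕ) : (hermiteReal k).Monic :=
  (Polynomial.hermite_monic k).map _

theorem natDegree_hermiteReal (k : ℕ) : (hermiteReal k).natDegree = k := by
  rw [hermiteReal, (Polynomial.hermite_monic k).natDegree_map, Polynomial.natDegree_hermite]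

theorem integral_mul_hermiteReal (k : ℕ) (p : Polynomial ℝ) :
    ∫ x : ℝ, (p * hermiteReal k).eval x * Real.exp (-x ^ 2 / 2)
      = ∫ x : ℝ, (Polynomial.derivative^[k] p).eval x * Real.exp (-x ^ 2 / 2) := by
  induction k generalizing p with
  | zero => simp [hermiteReal]
  | succ k ih =>
    rw [Function.iterate_succ_apply, ← ih, ← sub_eq_zero,
      ← integral_sub (integrable_polynomial_mul_gaussian _) (integrable_polynomial_mul_gaussian _),
      ← neg_eq_zero, ← integral_neg, ← integral_derivative_mul_gaussian (p * hermiteReal k)]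
    refine integral_congr_ae (.of_forall fun x => ?_)
    simp only [hermiteReal, Polynomial.hermite_succ, Polynomial.derivative_mul,
      Polynomial.map_sub, Polynomial.map_mul, Polynomial.map_X, Polynomial.eval_sub,
      Polynomial.eval_mul, Polynomial.eval_add, Polynomial.eval_X, Polynomial.derivative_map]
    ring

theorem integral_hermiteReal_mul_of_le {j k : ℕ} (h : j ≤ k) :
    ∫ x : ℝ, (hermiteReal j * hermiteReal k).eval x * Real.exp (-x ^ 2 / 2)
      = if j = k then (k.factorial : ℝ) * √(2 * Real.pi) else 0 := by
  rw [integral_mul_hermiteReal]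
  split_ifs with hjk
  · subst hjk
    have hd : Polynomial.derivative^[j] (hermiteReal j) = Polynomial.C (j.factorial : ℝ) := by
      ext m
      rw [Polynomial.coeff_iterate_derivative, Polynomial.coeff_C]
      split_ifs with hm
      · subst hm
        have := (hermiteReal_monic j).coeff_natDegree
        rw [natDegree_hermiteReal] at this
        rw [zero_add, this, Nat.descFactorial_self, nsmul_one]
      · rw [Polynomial.coeff_eq_zero_of_natDegree_lt, smul_zero]
        rw [natDegree_hermiteReal]
        omega
    have hg : ∫ x : ℝ, Real.exp (-x ^ 2 / 2) = √(2 * Real.pi) := by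
      have := integral_gaussian (1 / 2)
      rw [show 2 * Real.pi = Real.pi / (1 / 2) by ring, ← this]
      refine integral_congr_ae (.of_forall fun x => ?_)
      simp only
      congr 1
      ring
    simp only [hd, Polynomial.eval_C, integral_const_mul, hg]
  · rw [Polynomial.iterate_derivative_eq_zero
      (by rw [natDegree_hermiteReal]; exact lt_of_le_of_ne h hjk)]
    simp

theorem integral_hermiteReal_mul (j k : ℕ) :
    ∫ x : ℝ, (hermiteReal j).eval x * (hermiteReal k).eval x * Real.exp (-x ^ 2 / 2)
      = if j = k then (k.factorial : ℝ) * √(2 * Real.pi) else 0 := by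
  simp only [← Polynomial.eval_mul]
  rcases le_total j k with h | h
  · exact integral_hermiteReal_mul_of_le h
  · rw [mul_comm, integral_hermiteReal_mul_of_le h]
    by_cases hjk : j = k
    · simp [hjk]
    · rw [if_neg hjk, if_neg (Ne.symm hjk)]

theorem vandermondeSq_eq_sum {n : ℕ} (E : Fin n → ℝ) :
    vandermondeSq E = ∑ σ : Equiv.Perm (Fin n), ∑ τ : Equiv.Perm (Fin n),
      ((Equiv.Perm.sign σ : ℝ) * (Equiv.Perm.sign τ : ℝ)) *
        ∏ i, ((hermiteReal (σ i)).eval (E i) * (hermiteReal (τ i)).eval (E i)) := by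
  have h1 : vandermondeSq E = (Matrix.vandermonde E).det ^ 2 := by
    rw [vandermondeSq, Matrix.det_vandermonde, ← prod_pow, ← prod_pow]
    refine prod_congr rfl fun a _ => ?_
    rw [← prod_pow, ← prod_pow]
    exact prod_congr rfl fun b _ => by ring
  rw [h1, Matrix.det_eval_matrixOfPolynomials_eq_det_vandermonde E (fun j => hermiteReal j)
    (fun j => natDegree_hermiteReal j) (fun j => hermiteReal_monic j), ← Matrix.det_transpose,
    Matrix.det_apply', sq, sum_mul_sum]
  simp only [Matrix.transpose_apply, Matrix.of_apply, prod_mul_distrib]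
  refine sum_congr rfl fun σ _ => sum_congr rfl fun τ _ => ?_
  ring

/-- The normalization of the Gaussian unitary ensemble eigenvalue density. -/
theorem eigenMass_eq (n : ℕ) : (eigenMass n : ℝ)
    = n.factorial * ((∏ j ∈ range n, (j.factorial : ℝ)) * √(2 * Real.pi) ^ n) := by
  have hterm : ∀ (σ τ : Equiv.Perm (Fin n)) (E : Fin n → ℝ),
      ((Equiv.Perm.sign σ : ℝ) * (Equiv.Perm.sign τ : ℝ)) *
        (∏ i, ((hermiteReal (σ i)).eval (E i) * (hermiteReal (τ i)).eval (E i))) * eigenWeight E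
      = ((Equiv.Perm.sign σ : ℝ) * (Equiv.Perm.sign τ : ℝ)) *
        ∏ i, ((hermiteReal (σ i)).eval (E i) * (hermiteReal (τ i)).eval (E i) *
          Real.exp (-E i ^ 2 / 2)) := by
    intro σ τ E
    rw [prod_mul_distrib (g := fun i => Real.exp (-E i ^ 2 / 2)), ← Real.exp_sum, eigenWeight,
      ← sum_div, sum_neg_distrib, mul_assoc]
  have hint : ∀ σ τ : Equiv.Perm (Fin n), Integrable fun E : Fin n → ℝ =>
      ((Equiv.Perm.sign σ : ℝ) * (Equiv.Perm.sign τ : ℝ)) *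
        ∏ i, ((hermiteReal (σ i)).eval (E i) * (hermiteReal (τ i)).eval (E i) *
          Real.exp (-E i ^ 2 / 2)) := by
    intro σ τ
    refine Integrable.const_mul (Integrable.fintype_prod (f := fun i x =>
      ((hermiteReal (σ i)).eval x * (hermiteReal (τ i)).eval x * Real.exp (-x ^ 2 / 2)))
      fun i => ?_) _
    simpa only [Polynomial.eval_mul] using
      integrable_polynomial_mul_gaussian (hermiteReal (σ i) * hermiteReal (τ i))
  have h : (eigenMass n : ℝ) = ∫ E : Fin n → ℝ, vandermondeSq E * eigenWeight E := rfl
  rw [h]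
  simp only [vandermondeSq_eq_sum, sum_mul, hterm]
  rw [integral_finsetSum _ fun σ _ => integrable_finsetSum _ fun τ _ => hint σ τ]
  have hval : ∀ σ τ : Equiv.Perm (Fin n), ∫ E : Fin n → ℝ,
      ((Equiv.Perm.sign σ : ℝ) * (Equiv.Perm.sign τ : ℝ)) *
        ∏ i, ((hermiteReal (σ i)).eval (E i) * (hermiteReal (τ i)).eval (E i) *
          Real.exp (-E i ^ 2 / 2))
      = if σ = τ then (∏ j ∈ range n, (j.factorial : ℝ)) * √(2 * Real.pi) ^ n else 0 := by
    intro σ τ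
    rw [integral_const_mul, integral_fintype_prod_volume_eq_prod (fun i x =>
      ((hermiteReal (σ i)).eval x * (hermiteReal (τ i)).eval x * Real.exp (-x ^ 2 / 2)))]
    simp only [integral_hermiteReal_mul, Fin.val_inj]
    split_ifs with hστ
    · subst hστ
      have hs : (Equiv.Perm.sign σ : ℝ) * (Equiv.Perm.sign σ : ℝ) = 1 := by
        rcases Int.units_eq_one_or (Equiv.Perm.sign σ) with h | h <;> simp [h]
      rw [hs, one_mul]
      simp only [if_true, prod_mul_distrib, prod_const, card_univ, Fintype.card_fin]
      rw [Equiv.prod_comp σ fun j => ((j : ℕ).factorial : ℝ),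
        Fin.prod_univ_eq_prod_range fun j => (j.factorial : ℝ)]
    · obtain ⟨i, hi⟩ := not_forall.1 (mt Equiv.ext hστ)
      rw [prod_eq_zero (mem_univ i) (if_neg hi), mul_zero]
  simp only [integral_finsetSum _ fun τ _ => hint _ τ, hval, sum_ite_eq, mem_univ, if_true,
    sum_const, card_univ, Fintype.card_perm, Fintype.card_fin, nsmul_eq_mul]

theorem card_upperIdx_mul_two_add (n : ℕ) : Fintype.card (UpperIdx n) * 2 + n = n * n := by
  have h := sum_sum_eq_diag_add_upper (n := n) fun _ _ => (1 : ℕ)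
  simp only [sum_const, card_univ, Fintype.card_fin, smul_eq_mul, mul_one] at h
  omega

theorem card_upperIdx (n : ℕ) : Fintype.card (UpperIdx n) = ∑ j ∈ range n, j := by
  have h1 := card_upperIdx_mul_two_add n
  have h2 := sum_range_id_mul_two n
  rw [Nat.mul_sub_one] at h2
  omega

/-- The total mass of the Gaussian measure on Hermitian matrices. -/
theorem hermMass_eq (n : ℕ) : (hermMass n : ℝ)
    = √(2 * Real.pi) ^ n * ∏ j ∈ range n, Real.pi ^ j := by
  have h : (hermMass n : ℝ) = ∫ x : HermCoord n, hermWeight x := rfl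
  have hw : ∀ x : HermCoord n, hermWeight x = (∏ i, Real.exp (-(1 / 2) * x.1 i ^ 2)) *
      ((∏ p, Real.exp (-1 * x.2.1 p ^ 2)) * ∏ p, Real.exp (-1 * x.2.2 p ^ 2)) := by
    intro x
    rw [← Real.exp_sum, ← Real.exp_sum, ← Real.exp_sum, ← Real.exp_add, ← Real.exp_add, hermWeight,
      traceForm_self, ← mul_sum, ← mul_sum, ← mul_sum]
    congr 1
    ring
  rw [h]
  simp only [hw]
  have e1 : ∫ x : HermCoord n, (∏ i, Real.exp (-(1 / 2) * x.1 i ^ 2)) *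
      ((∏ p, Real.exp (-1 * x.2.1 p ^ 2)) * ∏ p, Real.exp (-1 * x.2.2 p ^ 2))
      = (∫ y : Fin n → ℝ, ∏ i, Real.exp (-(1 / 2) * y i ^ 2)) *
        ∫ z : (UpperIdx n → ℝ) × (UpperIdx n → ℝ),
          (∏ p, Real.exp (-1 * z.1 p ^ 2)) * ∏ p, Real.exp (-1 * z.2 p ^ 2) :=
    integral_prod_mul (μ := volume) (ν := volume)
      (fun y : Fin n → ℝ => ∏ i, Real.exp (-(1 / 2) * y i ^ 2))
      (fun z : (UpperIdx n → ℝ) × (UpperIdx n → ℝ) =>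
        (∏ p, Real.exp (-1 * z.1 p ^ 2)) * ∏ p, Real.exp (-1 * z.2 p ^ 2))
  have e2 : ∫ z : (UpperIdx n → ℝ) × (UpperIdx n → ℝ),
      (∏ p, Real.exp (-1 * z.1 p ^ 2)) * ∏ p, Real.exp (-1 * z.2 p ^ 2)
      = (∫ y : UpperIdx n → ℝ, ∏ p, Real.exp (-1 * y p ^ 2)) *
        ∫ y : UpperIdx n → ℝ, ∏ p, Real.exp (-1 * y p ^ 2) :=
    integral_prod_mul (μ := volume) (ν := volume)
      (fun y : UpperIdx n → ℝ => ∏ p, Real.exp (-1 * y p ^ 2))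
      (fun y : UpperIdx n → ℝ => ∏ p, Real.exp (-1 * y p ^ 2))
  rw [e1, e2, integral_fintype_prod_volume_eq_pow (fun x : ℝ => Real.exp (-(1 / 2) * x ^ 2)),
    integral_fintype_prod_volume_eq_pow (fun x : ℝ => Real.exp (-1 * x ^ 2)), integral_gaussian,
    integral_gaussian, Fintype.card_fin, ← mul_pow, div_one, Real.mul_self_sqrt Real.pi_pos.le,
    card_upperIdx, prod_pow_eq_pow_sum]
  congr 3
  ring

theorem weyl_constant_mul_eigenMass (n : ℕ) :
    ((1 / n.factorial : ℝ) * ∏ j ∈ Icc 1 n, Real.pi ^ (j - 1) / Real.Gamma j) * eigenMass n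
      = hermMass n := by
  have hprod : ∏ j ∈ Icc 1 n, Real.pi ^ (j - 1) / Real.Gamma j
      = ∏ j ∈ range n, Real.pi ^ j / (j.factorial : ℝ) := by
    rw [← Ico_add_one_right_eq_Icc, prod_Ico_eq_prod_range]
    refine prod_congr (by simp) fun j _ => ?_
    rw [add_comm 1 j, Nat.add_sub_cancel]
    push_cast
    rw [Real.Gamma_nat_eq_factorial]
  rw [hprod, prod_div_distrib, eigenMass_eq, hermMass_eq]
  have h1 : (∏ j ∈ range n, (j.factorial : ℝ)) ≠ 0 :=
    prod_ne_zero_iff.2 fun j _ => by positivity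
  have h2 : (n.factorial : ℝ) ≠ 0 := by positivity
  field_simp

theorem eigenMass_ne_zero (n : ℕ) : eigenMass n ≠ 0 := by
  intro h
  have h1 := weyl_constant_mul_eigenMass n
  rw [h, NNReal.coe_zero, mul_zero] at h1
  exact (integral_hermWeight_pos n).ne h1

/-- The Weyl eigenvalue integration formula on `Herm(n)` with the explicit constant
`g_n^{(2)} = (1/n!) ∏_{j=1}^n π^{j-1}/Γ(j)` (Eqs. (C.5) and (C.9) of the paper for β = 2). -/
theorem weyl_integration_herm (n : ℕ) (hn : 1 ≤ n)
    (f : Matrix (Fin n) (Fin n) ℂ → ℂ)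
    (hinv : ∀ H : Matrix (Fin n) (Fin n) ℂ, H.IsHermitian →
      ∀ U ∈ Matrix.unitaryGroup (Fin n) ℂ, f (U * H * star U) = f H)
    (hint : Integrable (fun p : (Fin n → ℝ) × (UpperIdx n → ℝ) × (UpperIdx n → ℝ) =>
      f (hermOf p.1 p.2.1 p.2.2))) :
    ∫ p : (Fin n → ℝ) × (UpperIdx n → ℝ) × (UpperIdx n → ℝ),
        f (hermOf p.1 p.2.1 p.2.2)
      = (((1 / n.factorial : ℝ) *
            ∏ j ∈ Finset.Icc 1 n, Real.pi ^ (j - 1) / Real.Gamma j : ℝ) : ℂ) *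
        ∫ E : Fin n → ℝ,
          (((∏ a : Fin n, ∏ b ∈ Finset.Ioi a, (E a - E b)) ^ 2 : ℝ) : ℂ) *
            f (Matrix.diagonal fun i => (E i : ℂ)) := by
  have h := weyl_integration_of_mass f hinv hint.aestronglyMeasurable
  have hc : (((eigenMass n : ℝ)) : ℂ) ≠ 0 :=
    Complex.ofReal_ne_zero.2 (NNReal.coe_ne_zero.2 (eigenMass_ne_zero n))
  refine mul_left_cancel₀ hc (h.trans ?_)
  rw [← weyl_constant_mul_eigenMass, Complex.ofReal_mul, mul_comm _ ((eigenMass n : ℝ) : ℂ),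
    mul_assoc]
  rfl
end
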